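/- Let X be a random variable with density f belonging to the integrated Pearson family IP(μ; δ, β, γ) with δ ≤ 0, let n ≥ 1, and let g ∈ H^{n,n}(X). Then |Var[g(X)] − S_{0,n}(g)| ≥ C(2n, n) · (∏_{j=n}^{2n−1}(1−jδ) / ∏_{j=0}^{n−1}(1−jδ)) · |Var[g(X)] − S_{n,n}(g)|, where the equality holds if and only if g coincides on the support (α, ω) of X with a polynomial of degree at most n (in which case Var[g(X)] = S_{n,n}(g) = S_{0,n}(g)). -/

import Mathlib

open MeasureTheory ProbabilityTheory Finset Filter

noncomputable section

/-- Falling factorial `(x)_k = x (x-1) ⋯ (x-k+1)`, with `(x)_0 = 1`. -/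
def fall (x : ℝ) (k : ℕ) : ℝ := ∏ j ∈ Finset.range k, (x - j)

/-- Rising factorial `[x]_k = x (x+1) ⋯ (x+k-1)`, with `[x]_0 = 1`. -/
def rise (x : ℝ) (k : ℕ) : ℝ := ∏ j ∈ Finset.range k, (x + j)

/-- The product `∏_{j=a}^{a+len-1} (1 - j δ)` of `len` consecutive factors
(an empty product is `1`). -/
def pp (δ a : ℝ) (len : ℕ) : ℝ := ∏ j ∈ Finset.range len, (1 - (a + j) * δ)

/-- The open real interval with (possibly infinite) endpoints `α ω : EReal`. -/
def erealIoo (α ω : EReal) : Set ℝ := {x : ℝ | α < (x : EReal) ∧ (x : EReal) < ω}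

/-- `g` coincides on `J` with a polynomial of degree at most `d`. -/
def IsPolyOn (g : ℝ → ℝ) (J : Set ℝ) (d : ℕ) : Prop :=
  ∃ p : Polynomial ℝ, p.natDegree ≤ d ∧ ∀ x ∈ J, g x = p.eval x

/-- The quadratic `q(x) = δ x² + β x + γ` of a Pearson family. -/
def pq (δ β γ : ℝ) : ℝ → ℝ := fun x => δ * x ^ 2 + β * x + γ

/-- `P` is the distribution of a random variable with density `f` (w.r.t. Lebesgue
measure) belonging to the integrated Pearson family `IP(μ; δ, β, γ)`:
`μ` is the (finite) mean of `P`, `|δ|+|β|+|γ| > 0`, and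
`∫_{-∞}^x (μ - t) f(t) dt = q(x) f(x)` for all `x`. -/
def IsIntegratedPearson (P : Measure ℝ) (f : ℝ → ℝ) (μ δ β γ : ℝ) : Prop :=
  IsProbabilityMeasure P ∧
  (∀ x, 0 ≤ f x) ∧
  P = volume.withDensity (fun x => ENNReal.ofReal (f x)) ∧
  Integrable (fun x : ℝ => x) P ∧
  μ = ∫ x, x ∂P ∧
  0 < |δ| + |β| + |γ| ∧
  ∀ x : ℝ, (∫ t in Set.Iic x, (μ - t) * f t) = pq δ β γ x * f x

/-- Membership in the class `H^{m,n}(X)` for the distribution `P` of `X` with Pearson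
quadratic `q` and support `J`.  Here `gd k` plays the role of the `k`-th derivative
`g^{(k)}` of `g = gd 0` on `J`.  With `ℓ = max m n`:  `g ∈ C^{ℓ-1}(J)`
(encoded by `gd k` having derivative `gd (k+1)` at every point of `J` for `k+1 < ℓ`,
and `gd (ℓ-1)` continuous on `J`), `g^{(ℓ-1)}` is absolutely continuous on `J` with
a.e. derivative `g^{(ℓ)} = gd ℓ` (encoded by the fundamental theorem of calculus:
`gd ℓ` is locally integrable and `gd (ℓ-1)` is its integral on every subinterval of `J`),
and the moment conditions `E[q(X)^n (g^{(n)}(X))²] < ∞` and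
`E[q(X)^i |g^{(i)}(X)|] < ∞` for `n < i ≤ m` hold. -/
def MemH (P : Measure ℝ) (q : ℝ → ℝ) (J : Set ℝ) (m n : ℕ) (gd : ℕ → ℝ → ℝ) : Prop :=
  (∀ k, k + 1 < max m n → ∀ x ∈ J, HasDerivAt (gd k) (gd (k + 1) x) x) ∧
  (1 ≤ max m n → ContinuousOn (gd (max m n - 1)) J) ∧
  (1 ≤ max m n → ∀ a ∈ J, ∀ b ∈ J,
    IntervalIntegrable (gd (max m n)) volume a b ∧
      gd (max m n - 1) b - gd (max m n - 1) a = ∫ t in a..b, gd (max m n) t) ∧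
  Integrable (fun x => q x ^ n * (gd n x) ^ 2) P ∧
  ∀ i, n < i → i ≤ m → Integrable (fun x => q x ^ i * |gd i x|) P

/-- The variance bound `S_{m,n}(g)` of Theorem 2.1, for a Pearson distribution `P`
with quadratic `q` and parameter `δ`. -/
def Sbound (P : Measure ℝ) (δ : ℝ) (q : ℝ → ℝ) (m n : ℕ) (gd : ℕ → ℝ → ℝ) : ℝ :=
  (∑ i ∈ Finset.Icc 1 m,
      ((m.choose i : ℝ) * pp δ ((m : ℝ) + i) n /
          (fall ((m : ℝ) + n) i * (∫ x, q x ^ i ∂P) * pp δ ((i : ℝ) - 1) i *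
            pp δ (m : ℝ) n)) *
        (∫ x, q x ^ i * gd i x ∂P) ^ 2) +
    ∑ i ∈ Finset.Icc 1 n,
      (-1 : ℝ) ^ (i - 1) *
          ((n.choose i : ℝ) / (fall ((m : ℝ) + n) i * pp δ (m : ℝ) i)) *
        ∫ x, q x ^ i * (gd i x) ^ 2 ∂P

section PartA
def lam (δ : ℝ) (k : ℕ) : ℝ := k * (1 - ((k : ℝ) - 1) * δ)
def piL (δ : ℝ) (i : ℕ) (x : ℝ) : ℝ := ∏ j ∈ Finset.range i, (x - lam δ j)
def Tp (δ : ℝ) (m n : ℕ) (x : ℝ) : ℝ := ∏ j ∈ Finset.range n, (1 - x / lam δ (m + 1 + j))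
def Bc (δ : ℝ) (m n i : ℕ) : ℝ := (n.choose i : ℝ) / (fall ((m : ℝ) + n) i * pp δ (m : ℝ) i)

lemma lam_zero (δ : ℝ) : lam δ 0 = 0 := by simp [lam]

lemma lam_sub (δ : ℝ) (k j : ℕ) : lam δ k - lam δ j = ((k:ℝ) - j) * (1 - ((k:ℝ) + j - 1) * δ) := by
  simp only [lam]; ring

lemma lam_lt {δ : ℝ} (hδ : δ ≤ 0) {j k : ℕ} (h : j < k) : lam δ j < lam δ k := by
  rw [← sub_pos, lam_sub]
  have h1 : (j:ℝ) + 1 ≤ k := by exact_mod_cast h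
  have h2 : (0:ℝ) ≤ j := by positivity
  apply mul_pos (by linarith)
  nlinarith

lemma lam_pos {δ : ℝ} (hδ : δ ≤ 0) {k : ℕ} (h : 0 < k) : 0 < lam δ k := by
  have := lam_lt hδ h; rwa [lam_zero] at this

lemma lam_inj {δ : ℝ} (hδ : δ ≤ 0) {j k : ℕ} (h : lam δ j = lam δ k) : j = k := by
  rcases lt_trichotomy j k with h1 | h1 | h1
  · exact absurd h (lam_lt hδ h1).ne
  · exact h1
  · exact absurd h (lam_lt hδ h1).ne'

lemma pp_pos {δ : ℝ} (hδ : δ ≤ 0) {a : ℝ} (ha : 0 ≤ a) (n : ℕ) : 0 < pp δ a n := by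
  apply Finset.prod_pos
  intro j _
  have : (0:ℝ) ≤ a + j := by positivity
  nlinarith

lemma fall_pos {a : ℝ} {i : ℕ} (h : (i:ℝ) ≤ a) : 0 < fall a i := by
  apply Finset.prod_pos
  intro j hj
  have : (j:ℝ) + 1 ≤ i := by exact_mod_cast Finset.mem_range.mp hj
  linarith

lemma fall_succ (a : ℝ) (i : ℕ) : fall a (i+1) = fall a i * (a - i) := by
  simp [fall, Finset.prod_range_succ]

lemma fall_succ' (a : ℝ) (i : ℕ) : fall (a+1) (i+1) = (a+1) * fall a i := by
  simp only [fall, Finset.prod_range_succ']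
  rw [mul_comm]; simp

lemma pp_succ (δ a : ℝ) (i : ℕ) : pp δ a (i+1) = pp δ a i * (1 - (a+i)*δ) := by
  simp [pp, Finset.prod_range_succ]

lemma pp_succ' (δ a : ℝ) (i : ℕ) : pp δ a (i+1) = (1 - a*δ) * pp δ (a+1) i := by
  simp only [pp, Finset.prod_range_succ']
  rw [mul_comm]; simp
  left
  apply Finset.prod_congr rfl; intro j _; ring

lemma piL_succ (δ : ℝ) (i : ℕ) (x : ℝ) : piL δ (i+1) x = piL δ i x * (x - lam δ i) := by
  simp [piL, Finset.prod_range_succ]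

lemma Tp_succ (δ : ℝ) (m n : ℕ) (x : ℝ) :
    Tp δ m (n+1) x = Tp δ m n x * (1 - x / lam δ (m+1+n)) := by
  simp [Tp, Finset.prod_range_succ]

lemma Tp_succ' (δ : ℝ) (m n : ℕ) (x : ℝ) :
    Tp δ m (n+1) x = (1 - x / lam δ (m+1)) * Tp δ (m+1) n x := by
  simp only [Tp, Finset.prod_range_succ']
  rw [mul_comm]; simp
  left
  apply Finset.prod_congr rfl; intro j _
  rw [show m+1+(j+1) = m+1+1+j by ring]

lemma Bc_zero_m {δ : ℝ} (hδ : δ ≤ 0) (n i : ℕ) (h : i ≤ n) :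
    Bc δ 0 n i = 1 / ((i.factorial : ℝ) * pp δ 0 i) := by
  have h1 : fall (((0:ℕ):ℝ) + n) i = (n.choose i : ℝ) * i.factorial := by
    clear hδ
    induction i with
    | zero => simp [fall]
    | succ i ih =>
      rw [fall_succ, ih (by omega)]
      have := Nat.choose_succ_right_eq n i
      have h2 : ((n.choose (i+1) : ℝ)) * (i+1) = n.choose i * (n - i) := by
        have : ((n - i : ℕ) : ℝ) = n - i := by push_cast [Nat.cast_sub (by omega : i ≤ n)]; ring
        rw [← this]; exact_mod_cast Nat.choose_succ_right_eq n i
      rw [Nat.factorial_succ]; push_cast; rw [zero_add]; linear_combination -(i.factorial:ℝ) * h2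
  have hc : (0:ℝ) < n.choose i := by exact_mod_cast Nat.choose_pos h
  have hp := pp_pos hδ le_rfl i
  simp only [Bc]
  rw [h1]
  simp only [Nat.cast_zero]
  have : (0:ℝ) < i.factorial := by exact_mod_cast i.factorial_pos
  field_simp

lemma piL_eq_Tp {δ : ℝ} (hδ : δ ≤ 0) (n : ℕ) (x : ℝ) :
    piL δ (n+1) x = (-1)^n * x * ((n.factorial : ℝ) * pp δ 0 n) * Tp δ 0 n x := by
  induction n with
  | zero => simp [piL, Tp, pp, lam_zero]
  | succ n ih =>
    rw [piL_succ, ih, Tp_succ, pp_succ, Nat.factorial_succ]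
    have := lam_pos hδ (Nat.succ_pos n)
    rw [show 0 + 1 + n = n+1 by ring]
    have h2 : lam δ (n+1) = (n+1) * (1 - n * δ) := by simp [lam]
    have h3 : (1 - x / lam δ (n+1)) * lam δ (n+1) = lam δ (n+1) - x := by
      field_simp
    have h4 : lam δ (n+1) - x = (1 - x / lam δ (n+1)) * ((n+1) * (1 - n * δ)) := by
      rw [← h3, ← h2]
    push_cast
    rw [show x - lam δ (n+1) = -(lam δ (n+1) - x) by ring, h4]
    ring

lemma T_expand_zero {δ : ℝ} (hδ : δ ≤ 0) (n : ℕ) (x : ℝ) :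
    ∑ i ∈ Finset.range (n+1), (-1:ℝ)^i * Bc δ 0 n i * piL δ i x = Tp δ 0 n x := by
  induction n with
  | zero => simp [Bc, fall, pp, piL, Tp]
  | succ n ih =>
    rw [Finset.sum_range_succ]
    have : ∑ i ∈ Finset.range (n+1), (-1:ℝ)^i * Bc δ 0 (n+1) i * piL δ i x
       = ∑ i ∈ Finset.range (n+1), (-1:ℝ)^i * Bc δ 0 n i * piL δ i x := by
      apply Finset.sum_congr rfl
      intro i hi
      have := Finset.mem_range.mp hi
      rw [Bc_zero_m hδ _ _ (by omega), Bc_zero_m hδ _ _ (by omega)]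
    rw [this, ih, Bc_zero_m hδ _ _ le_rfl, piL_eq_Tp hδ, Tp_succ]
    have h1 := pp_pos hδ le_rfl n
    have h2 : (0:ℝ) < n.factorial := by exact_mod_cast n.factorial_pos
    have h3 := lam_pos hδ (Nat.succ_pos n)
    have h4 : lam δ (n+1) = (n+1) * (1 - n * δ) := by simp [lam]
    have h5 : pp δ 0 (n+1) = pp δ 0 n * (1 - n*δ) := by rw [pp_succ]; simp
    have h6 : (((n+1).factorial : ℕ):ℝ) * pp δ 0 (n+1) = n.factorial * pp δ 0 n * lam δ (n+1) := by
      rw [h5, h4, Nat.factorial_succ]; push_cast; ring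
    rw [h6, show 0 + 1 + n = n+1 by ring, pow_succ]
    have h7 : ((-1:ℝ)^n)*((-1:ℝ)^n) = 1 := by rw [← mul_pow]; simp
    field_simp
    linear_combination (- Tp δ 0 n x * x) * h7

lemma Bc_rel {δ : ℝ} (hδ : δ ≤ 0) (m n i : ℕ) (hi : i ≤ n+1) :
    lam δ (m+n+2) * Bc δ (m+1) (n+1) i = lam δ (m+1) * Bc δ m (n+1) i
      + (lam δ (m+n+2) - lam δ (m+1)) * Bc δ (m+1) n i := by
  have hi' : (i:ℝ) ≤ n + 1 := by exact_mod_cast hi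
  have hm : (0:ℝ) ≤ m := by positivity
  have hn : (0:ℝ) ≤ n := by positivity
  have hc : ((n.choose i : ℝ)) * (n+1) = (n+1).choose i * (n+1-i) := by
    have : ((n + 1 - i : ℕ) : ℝ) = n + 1 - i := by push_cast [Nat.cast_sub hi]; ring
    rw [← this]; exact_mod_cast Nat.choose_mul_succ_eq n i
  have f1 : fall ((m:ℝ)+n+2) i * ((m:ℝ)+n+2-i) = (m+n+2) * fall ((m:ℝ)+n+1) i := by
    rw [← fall_succ, show (m:ℝ)+n+2 = (m+n+1)+1 by ring, fall_succ']
  have p1 : pp δ (m:ℝ) i * (1 - (m+i)*δ) = (1 - m*δ) * pp δ ((m:ℝ)+1) i := by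
    rw [← pp_succ, pp_succ']
  have F1 : 0 < fall ((m:ℝ)+n+2) i := fall_pos (by linarith)
  have F2 : 0 < fall ((m:ℝ)+n+1) i := fall_pos (by linarith)
  have P1 : 0 < pp δ (m:ℝ) i := pp_pos hδ hm i
  have P2 : 0 < pp δ ((m:ℝ)+1) i := pp_pos hδ (by linarith) i
  have hmd : 0 < 1 - m*δ := by nlinarith
  have hmi : 0 < 1 - (m+i)*δ := by nlinarith [(Nat.cast_nonneg i : (0:ℝ) ≤ i)]
  have e1 : fall ((m:ℝ)+n+2) i = (m+n+2) * fall ((m:ℝ)+n+1) i / ((m:ℝ)+n+2-i) := by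
    rw [eq_div_iff (by linarith), f1]
  have e2 : pp δ (m:ℝ) i = (1 - m*δ) * pp δ ((m:ℝ)+1) i / (1 - (m+i)*δ) := by
    rw [eq_div_iff hmi.ne', p1]
  have e3 : (n.choose i : ℝ) = (n+1).choose i * (n+1-i) / (n+1) := by
    rw [eq_div_iff (by linarith), hc]
  have hX : (m:ℝ)+n+2-i ≠ 0 := by linarith
  simp only [Bc]
  push_cast
  rw [show (m:ℝ)+1+(n+1) = m+n+2 by ring, show (m:ℝ)+(n+1) = m+n+1 by ring,
    show (m:ℝ)+1+n = m+n+1 by ring, e1, e2, e3]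
  simp only [lam]
  push_cast
  have hn1 : (n:ℝ)+1 ≠ 0 := by linarith
  have hmn : (m:ℝ)+n+2 ≠ 0 := by linarith
  field_simp
  ring

lemma T_rel {δ : ℝ} (hδ : δ ≤ 0) (m n : ℕ) (x : ℝ) :
    lam δ (m+n+2) * Tp δ (m+1) (n+1) x = lam δ (m+1) * Tp δ m (n+1) x
      + (lam δ (m+n+2) - lam δ (m+1)) * Tp δ (m+1) n x := by
  rw [Tp_succ, Tp_succ', show m+1+1+n = m+n+2 by ring]
  have h1 := lam_pos hδ (show 0 < m+n+2 by omega)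
  have h2 := lam_pos hδ (show 0 < m+1 by omega)
  field_simp
  ring

lemma T_expand {δ : ℝ} (hδ : δ ≤ 0) (n m : ℕ) (x : ℝ) :
    ∑ i ∈ Finset.range (n+1), (-1:ℝ)^i * Bc δ m n i * piL δ i x = Tp δ m n x := by
  induction n generalizing m with
  | zero => simp [Bc, fall, pp, piL, Tp]
  | succ n ihn =>
    induction m with
    | zero => exact T_expand_zero hδ _ x
    | succ m ihm =>
      have h1 := lam_pos hδ (show 0 < m+n+2 by omega)
      apply mul_left_cancel₀ h1.ne'
      rw [T_rel hδ, ← ihm, ← ihn]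
      have h2 : ∑ i ∈ Finset.range (n+1), (-1:ℝ)^i * Bc δ (m+1) n i * piL δ i x =
          ∑ i ∈ Finset.range (n+1+1), (-1:ℝ)^i * Bc δ (m+1) n i * piL δ i x := by
        rw [Finset.sum_range_succ _ (n+1)]; simp [Bc]
      rw [h2, Finset.mul_sum, Finset.mul_sum, Finset.mul_sum, ← Finset.sum_add_distrib]
      apply Finset.sum_congr rfl
      intro i hi
      have := Bc_rel hδ m n i (by have := Finset.mem_range.mp hi; omega)
      linear_combination ((-1:ℝ)^i * piL δ i x) * this

/-- value of `π_i(λ_i)`. -/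
lemma piL_self (δ : ℝ) (i : ℕ) : piL δ i (lam δ i) = (i.factorial : ℝ) * pp δ ((i:ℝ)-1) i := by
  rw [piL, pp]
  have : (i.factorial : ℝ) = ∏ j ∈ Finset.range i, ((i:ℝ) - j) := by
    rw [← Finset.prod_range_reflect, ← Finset.prod_range_add_one_eq_factorial]
    push_cast
    apply Finset.prod_congr rfl
    intro j hj
    have hj := Finset.mem_range.mp hj
    rw [Nat.sub_sub, Nat.cast_sub (by omega)]; push_cast; ring
  rw [this, ← Finset.prod_mul_distrib]
  apply Finset.prod_congr rfl
  intro j _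
  rw [lam_sub]; ring

lemma fall_swap (n i : ℕ) (hi : i ≤ n) : ∏ j ∈ Finset.range n, (((n+1+j:ℕ):ℝ) - i)/((n+1+j:ℕ):ℝ)
    = (n.choose i : ℝ) * i.factorial / fall ((n:ℝ)+n) i := by
  induction i with
  | zero =>
    simp [fall]
    exact (Finset.prod_pos fun j _ => by positivity).ne'
  | succ i ih =>
    have hin : ((i:ℝ)+1) ≤ n := by exact_mod_cast hi
    have tele : (∏ j ∈ Finset.range n, (((n+1+j:ℕ):ℝ) - (i+1:ℕ))/((n+1+j:ℕ):ℝ)) * (n+n-i)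
       = (∏ j ∈ Finset.range n, (((n+1+j:ℕ):ℝ) - i)/((n+1+j:ℕ):ℝ)) * (n - i) := by
      rw [Finset.prod_div_distrib, Finset.prod_div_distrib, div_mul_eq_mul_div, div_mul_eq_mul_div]
      congr 1
      have g : ∀ N : ℕ, (∏ j ∈ Finset.range N, (((n+1+j:ℕ):ℝ) - (i+1:ℕ))) * (n+N-i)
         = (∏ j ∈ Finset.range N, (((n+1+j:ℕ):ℝ) - i)) * (n - i) := by
        intro N
        induction N with
        | zero => simp
        | succ N ihN =>
          rw [Finset.prod_range_succ, Finset.prod_range_succ]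
          push_cast at ihN ⊢
          linear_combination (n+1+N-i:ℝ) * ihN
      exact g n
    rw [ih (by omega)] at tele
    rw [fall_succ]
    have h2 : ((n.choose (i+1) : ℝ)) * (i+1) = n.choose i * (n - i) := by
      have : ((n - i : ℕ) : ℝ) = n - i := by push_cast [Nat.cast_sub (by omega : i ≤ n)]; ring
      rw [← this]; exact_mod_cast Nat.choose_succ_right_eq n i
    have hf : 0 < fall ((n:ℝ)+n) i := fall_pos (by linarith)
    have hp : (0:ℝ) < n+n-i := by linarith
    rw [eq_div_iff (by positivity)]
    rw [Nat.factorial_succ]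
    push_cast at tele ⊢
    rw [div_mul_eq_mul_div, eq_div_iff hf.ne'] at tele
    linear_combination tele - (i.factorial:ℝ) * h2

lemma Tp_self {δ : ℝ} (hδ : δ ≤ 0) (n i : ℕ) (hi : i ≤ n) :
    Tp δ n n (lam δ i) = (n.choose i : ℝ) * i.factorial * pp δ ((n:ℝ)+i) n /
      (fall ((n:ℝ)+n) i * pp δ (n:ℝ) n) := by
  have : Tp δ n n (lam δ i) = (∏ j ∈ Finset.range n, (((n+1+j:ℕ):ℝ) - i)/((n+1+j:ℕ):ℝ)) *
     (pp δ ((n:ℝ)+i) n / pp δ (n:ℝ) n) := by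
    rw [Tp, pp, pp, ← Finset.prod_div_distrib, ← Finset.prod_mul_distrib]
    apply Finset.prod_congr rfl
    intro j _
    have h1 := lam_pos hδ (show 0 < n+1+j by omega)
    have h2 : lam δ (n+1+j) = ((n+1+j:ℕ):ℝ) * (1 - (n+j)*δ) := by simp only [lam]; push_cast; ring
    have h3 : (0:ℝ) < ((n+1+j:ℕ):ℝ) := by positivity
    have h4 : 0 < 1 - ((n:ℝ)+j)*δ := by nlinarith [(by positivity : (0:ℝ) ≤ (n:ℝ)+j)]
    have h5 : 1 - lam δ i / lam δ (n+1+j) = (lam δ (n+1+j) - lam δ i)/lam δ (n+1+j) := by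
      field_simp
    rw [h5, lam_sub, h2]
    push_cast at h3 ⊢
    field_simp
    ring
  rw [this, fall_swap n i hi, div_mul_div_comm]

lemma Tp_eq_zero {δ : ℝ} (hδ : δ ≤ 0) {m n k : ℕ} (h1 : m < k) (h2 : k ≤ m + n) :
    Tp δ m n (lam δ k) = 0 := by
  apply Finset.prod_eq_zero (i := k - (m+1)) (Finset.mem_range.mpr (by omega))
  rw [show m + 1 + (k - (m+1)) = k by omega, div_self (lam_pos hδ (by omega)).ne', sub_self]

/-- the ratio constant. -/
lemma ratio_eq {δ : ℝ} (hδ : δ ≤ 0) (n : ℕ) : ((2 * n).choose n : ℝ) * (pp δ (n : ℝ) n / pp δ 0 n)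
    = (∏ j ∈ Finset.range n, lam δ (n+1+j)) / ∏ j ∈ Finset.range n, lam δ (0+1+j) := by
  have e1 : ∀ m : ℕ, ∏ j ∈ Finset.range n, lam δ (m+1+j) =
      (∏ j ∈ Finset.range n, ((m+1+j:ℕ):ℝ)) * pp δ (m:ℝ) n := by
    intro m
    rw [pp, ← Finset.prod_mul_distrib]
    apply Finset.prod_congr rfl
    intro j _
    simp only [lam]; push_cast; ring
  have e2 : ∀ m : ℕ, (∏ j ∈ Finset.range n, ((m+1+j:ℕ):ℝ)) = ((m+1).ascFactorial n : ℝ) := by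
    intro m
    rw [Nat.ascFactorial_eq_prod_range]; push_cast; rfl
  have e3 : ((n+1).ascFactorial n : ℝ) = (n.factorial : ℝ) * (2*n).choose n := by
    have := Nat.ascFactorial_eq_factorial_mul_choose n n
    rw [show 2*n = n+n by ring]; exact_mod_cast this
  rw [e1, e1, e2, e2, e3]
  have e4 : ((0+1).ascFactorial n : ℝ) = n.factorial := by
    simp [Nat.one_ascFactorial]
  rw [e4]
  have := pp_pos hδ (le_refl 0) n
  have : (0:ℝ) < n.factorial := by exact_mod_cast n.factorial_pos
  simp only [Nat.cast_zero]
  field_simp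

/-- `|∏ (1-λ_k/λ_j)| ∏ λ_j` compared. -/
lemma Tp_abs {δ : ℝ} (hδ : δ ≤ 0) {m n k : ℕ} :
    (-1:ℝ)^n * Tp δ m n (lam δ k) * (∏ j ∈ Finset.range n, lam δ (m+1+j))
      = ∏ j ∈ Finset.range n, (lam δ k - lam δ (m+1+j)) := by
  rw [Tp, mul_assoc, ← Finset.prod_mul_distrib]
  rw [show (-1:ℝ)^n = ∏ j ∈ Finset.range n, (-1:ℝ) by simp, ← Finset.prod_mul_distrib]
  apply Finset.prod_congr rfl
  intro j _
  have h1 := lam_pos hδ (show 0 < m+1+j by omega)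
  field_simp
  ring

lemma prod_lam_pos {δ : ℝ} (hδ : δ ≤ 0) (m n : ℕ) : 0 < ∏ j ∈ Finset.range n, lam δ (m+1+j) :=
  Finset.prod_pos fun j _ => lam_pos hδ (by omega)

/-- The key termwise strict inequality. -/
lemma key_ineq {δ : ℝ} (hδ : δ ≤ 0) {n k : ℕ} (hn : 1 ≤ n) (hk : n < k) :
    0 ≤ (-1:ℝ)^n * Tp δ n n (lam δ k) ∧
    ((2 * n).choose n : ℝ) * (pp δ (n : ℝ) n / pp δ 0 n) * ((-1:ℝ)^n * Tp δ n n (lam δ k)) <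
      (-1:ℝ)^n * Tp δ 0 n (lam δ k) := by
  have a0 := Tp_abs hδ (m := 0) (n := n) (k := k)
  have p0 := prod_lam_pos hδ 0 n
  have pn := prod_lam_pos hδ n n
  have pos0 : 0 < ∏ j ∈ Finset.range n, (lam δ k - lam δ (0+1+j)) :=
    Finset.prod_pos fun j hj => sub_pos.mpr (lam_lt hδ (by have := Finset.mem_range.mp hj; omega))
  by_cases h2 : k ≤ 2*n
  · rw [Tp_eq_zero hδ hk (by omega)]
    refine ⟨by simp, ?_⟩
    simp only [mul_zero]
    rw [← a0] at pos0
    exact pos_of_mul_pos_left pos0 p0.le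
  · push Not at h2
    have an := Tp_abs hδ (m := n) (n := n) (k := k)
    have posn : 0 < ∏ j ∈ Finset.range n, (lam δ k - lam δ (n+1+j)) :=
      Finset.prod_pos fun j hj => sub_pos.mpr (lam_lt hδ (by have := Finset.mem_range.mp hj; omega))
    have lt : ∏ j ∈ Finset.range n, (lam δ k - lam δ (n+1+j)) <
        ∏ j ∈ Finset.range n, (lam δ k - lam δ (0+1+j)) := by
      apply Finset.prod_lt_prod_of_nonempty
      · intro j hj
        exact sub_pos.mpr (lam_lt hδ (by have := Finset.mem_range.mp hj; omega))
      · intro j hj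
        have := lam_lt hδ (show 0+1+j < n+1+j by omega)
        linarith
      · exact Finset.nonempty_range_iff.mpr (by omega)
    refine ⟨?_, ?_⟩
    · rw [← an] at posn
      exact (pos_of_mul_pos_left posn pn.le).le
    · rw [ratio_eq hδ, div_mul_eq_mul_div, div_lt_iff₀ p0, a0, mul_comm _ ((-1:ℝ)^n * _), an]
      exact lt
end PartA

section PartB
open scoped ENNReal

lemma mem_uIoc_iff' (c x t : ℝ) : t ∈ Set.uIoc c x ↔ x ∈ (if c < t then Set.Ici t else Set.Iio t) := by
  rw [Set.mem_uIoc]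
  split_ifs with h
  · simp only [Set.mem_Ici]
    constructor
    · rintro (h1 | h1)
      · exact h1.2
      · linarith [h1.2]
    · intro h1; exact Or.inl ⟨h, h1⟩
  · simp only [Set.mem_Iio]
    constructor
    · rintro (h1 | h1)
      · exact absurd h1.1 h
      · exact h1.1
    · intro h1; exact Or.inr ⟨h1, not_lt.mp h⟩

lemma measurableSet_kern (c : ℝ) : MeasurableSet {p : ℝ × ℝ | p.2 ∈ Set.uIoc c p.1} := by
  have : {p : ℝ × ℝ | p.2 ∈ Set.uIoc c p.1} =
     ({p : ℝ × ℝ | c < p.2} ∩ {p | p.2 ≤ p.1}) ∪ ({p | p.1 < p.2} ∩ {p | p.2 ≤ c}) := by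
    ext p; simp [Set.mem_uIoc]
  rw [this]
  exact ((measurableSet_lt measurable_const measurable_snd).inter
    (measurableSet_le measurable_snd measurable_fst)).union
    ((measurableSet_lt measurable_fst measurable_snd).inter
    (measurableSet_le measurable_snd measurable_const))

lemma measurableSet_ite' (c t : ℝ) : MeasurableSet (if c < t then Set.Ici t else Set.Iio t) := by
  split_ifs
  exacts [measurableSet_Ici, measurableSet_Iio]

lemma tonelli_kern (c : ℝ) (u v : ℝ → ℝ≥0∞) (hu : Measurable u) (hv : Measurable v) :
    ∫⁻ x, v x * ∫⁻ t in Set.uIoc c x, u t =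
      ∫⁻ t, u t * ∫⁻ x in (if c < t then Set.Ici t else Set.Iio t), v x := by
  set S : Set (ℝ × ℝ) := {p : ℝ × ℝ | p.2 ∈ Set.uIoc c p.1} with hS
  have hSm : MeasurableSet S := measurableSet_kern c
  have hG : Measurable (S.indicator fun p : ℝ × ℝ => v p.1 * u p.2) :=
    ((hv.comp measurable_fst).mul (hu.comp measurable_snd)).indicator hSm
  have h1 : ∀ x, v x * ∫⁻ t in Set.uIoc c x, u t =
      ∫⁻ t, S.indicator (fun p : ℝ × ℝ => v p.1 * u p.2) (x, t) := by
    intro x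
    rw [← lintegral_const_mul _ hu, ← lintegral_indicator measurableSet_uIoc]
    apply lintegral_congr
    intro t
    by_cases h : t ∈ Set.uIoc c x
    · rw [Set.indicator_of_mem h, Set.indicator_of_mem (show (x,t) ∈ S from h)]
    · rw [Set.indicator_of_notMem h, Set.indicator_of_notMem (show (x,t) ∉ S from h)]
  have h2 : ∀ t, u t * ∫⁻ x in (if c < t then Set.Ici t else Set.Iio t), v x =
      ∫⁻ x, S.indicator (fun p : ℝ × ℝ => v p.1 * u p.2) (x, t) := by
    intro t
    rw [← lintegral_const_mul _ hv, ← lintegral_indicator (measurableSet_ite' c t)]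
    apply lintegral_congr
    intro x
    by_cases h : t ∈ Set.uIoc c x
    · rw [Set.indicator_of_mem ((mem_uIoc_iff' c x t).mp h),
        Set.indicator_of_mem (show (x,t) ∈ S from h), mul_comm]
    · rw [Set.indicator_of_notMem (fun h' => h ((mem_uIoc_iff' c x t).mpr h')),
        Set.indicator_of_notMem (show (x,t) ∉ S from h)]
  simp_rw [h1, h2]
  exact lintegral_lintegral_swap hG.aemeasurable

lemma cs_kern (c x : ℝ) (hd : ℝ → ℝ) (hm : Measurable hd) :
    (∫⁻ t in Set.uIoc c x, ‖hd t‖ₑ)^2 ≤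
      ENNReal.ofReal |x - c| * ∫⁻ t in Set.uIoc c x, ‖hd t‖ₑ^2 := by
  have h := ENNReal.lintegral_mul_le_Lp_mul_Lq (volume.restrict (Set.uIoc c x))
    (p := 2) (q := 2) (by constructor <;> norm_num) (f := fun t => ‖hd t‖ₑ) (g := fun _ => 1)
    hm.enorm.aemeasurable aemeasurable_const
  simp only [Pi.mul_apply, mul_one, ENNReal.one_rpow, lintegral_const, one_mul,
    Measure.restrict_apply MeasurableSet.univ, Set.univ_inter, Real.volume_uIoc] at h
  have h2 := pow_le_pow_left₀ zero_le h 2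
  refine h2.trans (le_of_eq ?_)
  rw [mul_pow, mul_comm]
  have e : ∀ z : ℝ≥0∞, (z ^ ((1:ℝ)/2))^2 = z := by
    intro z
    rw [← ENNReal.rpow_natCast, ← ENNReal.rpow_mul]; norm_num
  rw [e, e]
  norm_cast

/-- Poincaré-type core inequality. -/
lemma poincare_core (w A hd : ℝ → ℝ) (c : ℝ) (hw : Measurable w) (hw0 : ∀ x, 0 ≤ w x)
    (hm : Measurable hd) (hInt : Integrable fun x => (c - x) * w x)
    (hA : ∀ t, ∫ x in Set.Iic t, (c - x) * w x = A t) (h0 : ∫ x, (c - x) * w x = 0) :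
    ∫⁻ x, ENNReal.ofReal (w x) * (∫⁻ t in Set.uIoc c x, ‖hd t‖ₑ)^2 ≤
      ∫⁻ t, ‖hd t‖ₑ^2 * ENNReal.ofReal (A t) := by
  have hv : Measurable fun x => ENNReal.ofReal (|x - c| * w x) := by fun_prop
  calc ∫⁻ x, ENNReal.ofReal (w x) * (∫⁻ t in Set.uIoc c x, ‖hd t‖ₑ)^2
      ≤ ∫⁻ x, ENNReal.ofReal (|x - c| * w x) * ∫⁻ t in Set.uIoc c x, ‖hd t‖ₑ^2 := by
        apply lintegral_mono
        intro x
        dsimp only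
        rw [ENNReal.ofReal_mul (abs_nonneg _), mul_comm (ENNReal.ofReal |x - c|), mul_assoc]
        gcongr
        exact cs_kern c x hd hm
    _ = ∫⁻ t, ‖hd t‖ₑ^2 * ∫⁻ x in (if c < t then Set.Ici t else Set.Iio t),
          ENNReal.ofReal (|x - c| * w x) :=
        tonelli_kern c _ _ (hm.enorm.pow_const 2) hv
    _ = ∫⁻ t, ‖hd t‖ₑ^2 * ENNReal.ofReal (A t) := by
        apply lintegral_congr
        intro t
        congr 1
        split_ifs with h
        · have e1 : ∫⁻ x in Set.Ici t, ENNReal.ofReal (|x - c| * w x) =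
              ∫⁻ x in Set.Ici t, ENNReal.ofReal (-((c - x) * w x)) := by
            apply setLIntegral_congr_fun measurableSet_Ici
            intro x hx
            have : c < x := lt_of_lt_of_le h hx
            dsimp only
            rw [abs_of_pos (by linarith)]; congr 1; ring
          rw [e1, ← ofReal_integral_eq_lintegral_ofReal]
          · congr 1
            rw [integral_neg, integral_Ici_eq_integral_Ioi]
            have := setIntegral_compl (μ := volume) (measurableSet_Iic (a := t)) hInt
            rw [Set.compl_Iic, h0, hA] at this
            rw [this]; ring
          · exact hInt.neg.integrableOn
          · refine (ae_restrict_iff' measurableSet_Ici).mpr (ae_of_all _ fun x hx => ?_)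
            have : c < x := lt_of_lt_of_le h hx
            have := hw0 x
            simp only [Pi.zero_apply]
            nlinarith
        · push Not at h
          have e1 : ∫⁻ x in Set.Iio t, ENNReal.ofReal (|x - c| * w x) =
              ∫⁻ x in Set.Iio t, ENNReal.ofReal ((c - x) * w x) := by
            apply setLIntegral_congr_fun measurableSet_Iio
            intro x hx
            have : x < c := lt_of_lt_of_le hx h
            dsimp only
            rw [abs_of_neg (by linarith)]; congr 1; ring
          rw [e1, ← ofReal_integral_eq_lintegral_ofReal]
          · rw [← integral_Iic_eq_integral_Iio, hA]
          · exact hInt.integrableOn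
          · refine (ae_restrict_iff' measurableSet_Iio).mpr (ae_of_all _ fun x hx => ?_)
            have : x < c := lt_of_lt_of_le hx h
            have := hw0 x
            simp only [Pi.zero_apply]
            nlinarith

/-- Integration by parts via Fubini. -/
lemma ibp_core (w φ hd B : ℝ → ℝ) (c : ℝ) (hw : Measurable w) (hw0 : ∀ x, 0 ≤ w x)
    (hm : Measurable hd) (hφ : Measurable φ)
    (hfin : ∫⁻ x, ENNReal.ofReal (w x) * (∫⁻ t in Set.uIoc c x, ‖hd t‖ₑ)^2 ≠ ∞)
    (hi1 : Integrable fun x => φ x * w x) (hi2 : Integrable fun x => φ x ^ 2 * w x)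
    (hB : ∀ t, ∫ x in Set.Iic t, φ x * w x = B t) (h0 : ∫ x, φ x * w x = 0) :
    ∫ x, (∫ t in c..x, hd t) * (φ x * w x) = - ∫ t, hd t * B t := by
  set S : Set (ℝ × ℝ) := {p : ℝ × ℝ | p.2 ∈ Set.uIoc c p.1} with hS
  have hSm : MeasurableSet S := measurableSet_kern c
  let sg : ℝ → ℝ := fun t => if c < t then 1 else -1
  have hsg : Measurable sg := Measurable.ite measurableSet_Ioi measurable_const measurable_const
  let G : ℝ × ℝ → ℝ := S.indicator fun p => (φ p.1 * w p.1) * (sg p.2 * hd p.2)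
  have hGm : Measurable G :=
    (((hφ.comp measurable_fst).mul (hw.comp measurable_fst)).mul
      ((hsg.comp measurable_snd).mul (hm.comp measurable_snd))).indicator hSm
  have hGi : Integrable G (volume.prod volume) := by
    refine ⟨hGm.aestronglyMeasurable, ?_⟩
    rw [hasFiniteIntegral_iff_enorm, lintegral_prod _ hGm.enorm.aemeasurable]
    have e1 : ∀ x, ∫⁻ t, ‖G (x,t)‖ₑ = ENNReal.ofReal (|φ x| * w x) *
        ∫⁻ t in Set.uIoc c x, ‖hd t‖ₑ := by
      intro x
      rw [← lintegral_const_mul _ hm.enorm, ← lintegral_indicator measurableSet_uIoc]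
      apply lintegral_congr
      intro t
      by_cases h : t ∈ Set.uIoc c x
      · rw [Set.indicator_of_mem h]
        simp only [G]
        rw [Set.indicator_of_mem (show (x,t) ∈ S from h), enorm_mul, enorm_mul (sg t)]
        have : ‖sg t‖ₑ = 1 := by
          simp only [sg]; split_ifs <;> simp
        rw [this, one_mul, Real.enorm_eq_ofReal_abs (φ x * w x), abs_mul, abs_of_nonneg (hw0 x)]
      · rw [Set.indicator_of_notMem h]
        simp only [G]
        rw [Set.indicator_of_notMem (show (x,t) ∉ S from h)]; simp
    simp_rw [e1]
    have bd : ∀ x, ENNReal.ofReal (|φ x| * w x) * ∫⁻ t in Set.uIoc c x, ‖hd t‖ₑ ≤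
        ENNReal.ofReal (φ x ^ 2 * w x) +
          ENNReal.ofReal (w x) * (∫⁻ t in Set.uIoc c x, ‖hd t‖ₑ)^2 := by
      intro x
      generalize (∫⁻ t in Set.uIoc c x, ‖hd t‖ₑ) = I
      rw [ENNReal.ofReal_mul (abs_nonneg _), ENNReal.ofReal_mul (sq_nonneg _), mul_assoc,
        mul_left_comm, mul_comm (ENNReal.ofReal (φ x ^2)), ← mul_add]
      gcongr
      rw [← sq_abs, ENNReal.ofReal_pow (abs_nonneg _)]
      generalize ENNReal.ofReal |φ x| = a
      rcases le_total a I with h | h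
      · calc a * I ≤ I * I := by gcongr
          _ = I^2 := by ring
          _ ≤ _ := le_add_self
      · calc a * I ≤ a * a := by gcongr
          _ = a^2 := by ring
          _ ≤ _ := le_self_add
    refine lt_of_le_of_lt (lintegral_mono bd) ?_
    rw [lintegral_add_left (by fun_prop)]
    refine ENNReal.add_lt_top.mpr ⟨?_, lt_top_iff_ne_top.mpr hfin⟩
    exact Integrable.lintegral_lt_top hi2
  have hswap := integral_integral_swap (f := fun x t => G (x,t)) hGi
  have l1 : ∀ x, ∫ t, G (x,t) = (∫ t in c..x, hd t) * (φ x * w x) := by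
    intro x
    have : (fun t => G (x,t)) = (Set.uIoc c x).indicator (fun t => (φ x * w x) * (sg t * hd t)) := by
      ext t
      by_cases h : t ∈ Set.uIoc c x
      · rw [Set.indicator_of_mem h]; simp only [G]
        rw [Set.indicator_of_mem (show (x,t) ∈ S from h)]
      · rw [Set.indicator_of_notMem h]; simp only [G]
        rw [Set.indicator_of_notMem (show (x,t) ∉ S from h)]
    rw [this, integral_indicator measurableSet_uIoc, integral_const_mul, mul_comm]
    congr 1
    rcases le_or_gt c x with h | h
    · rw [intervalIntegral.integral_of_le h, Set.uIoc_of_le h]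
      apply setIntegral_congr_fun measurableSet_Ioc
      intro t ht
      simp [sg, ht.1]
    · rw [intervalIntegral.integral_of_ge h.le, Set.uIoc_of_ge h.le, ← integral_neg]
      apply setIntegral_congr_fun measurableSet_Ioc
      intro t ht
      simp [sg, not_lt.mpr ht.2]
  have l2 : ∀ t, ∫ x, G (x,t) = -(hd t * B t) := by
    intro t
    have : (fun x => G (x,t)) = (if c < t then Set.Ici t else Set.Iio t).indicator
        (fun x => (sg t * hd t) * (φ x * w x)) := by
      ext x
      by_cases h : t ∈ Set.uIoc c x
      · rw [Set.indicator_of_mem ((mem_uIoc_iff' c x t).mp h)]; simp only [G]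
        rw [Set.indicator_of_mem (show (x,t) ∈ S from h), mul_comm]
      · rw [Set.indicator_of_notMem (fun h' => h ((mem_uIoc_iff' c x t).mpr h'))]; simp only [G]
        rw [Set.indicator_of_notMem (show (x,t) ∉ S from h)]
    rw [this, integral_indicator (measurableSet_ite' c t), integral_const_mul]
    split_ifs with h
    · rw [integral_Ici_eq_integral_Ioi]
      have e := setIntegral_compl (μ := volume) (measurableSet_Iic (a := t)) hi1
      rw [Set.compl_Iic, h0, hB] at e
      rw [e]; simp [sg, h]
    · rw [← integral_Iic_eq_integral_Iio, hB]; simp [sg, h]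
  simp_rw [l1, l2] at hswap
  rw [hswap, integral_neg]
end PartB

section PartC
open scoped ENNReal

/-- The quadratic as a polynomial. -/
def Qp (δ β γ : ℝ) : Polynomial ℝ :=
  Polynomial.C δ * Polynomial.X ^ 2 + Polynomial.C β * Polynomial.X + Polynomial.C γ

lemma Qp_eval (δ β γ x : ℝ) : (Qp δ β γ).eval x = pq δ β γ x := by simp [Qp, pq]

/-- Derived facts on a Pearson density. -/
structure PF (f : ℝ → ℝ) (J : Set ℝ) (μ δ β γ : ℝ) : Prop where
  hδ : δ ≤ 0
  fmeas : Measurable f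
  fnn : ∀ x, 0 ≤ f x
  fpos : ∀ x ∈ J, 0 < f x
  fzero : ∀ x, x ∉ J → f x = 0
  Jopen : IsOpen J
  Jord : J.OrdConnected
  Jne : J.Nonempty
  qpos : ∀ x ∈ J, 0 < pq δ β γ x
  expint : ∃ c > 0, Integrable fun x => Real.exp (c * |x|) * f x
  id1 : ∀ (s : Polynomial ℝ) (t : ℝ), ∫ x in Set.Iic t,
    (s.derivative * Qp δ β γ + s * (Polynomial.C μ - Polynomial.X)).eval x * f x
      = s.eval t * pq δ β γ t * f t
  id0 : ∀ s : Polynomial ℝ, ∫ x,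
    (s.derivative * Qp δ β γ + s * (Polynomial.C μ - Polynomial.X)).eval x * f x = 0

/-- fundamental theorem of calculus on `J`. -/
def FTC (J : Set ℝ) (h hd : ℝ → ℝ) : Prop := ∀ a ∈ J, ∀ b ∈ J,
  IntervalIntegrable hd volume a b ∧ h b - h a = ∫ t in a..b, hd t

def wt (f : ℝ → ℝ) (δ β γ : ℝ) (i : ℕ) (x : ℝ) : ℝ := pq δ β γ x ^ i * f x

/-- `ℓ_i`. -/
def ellp (μ δ β : ℝ) (i : ℕ) : Polynomial ℝ :=
  Polynomial.C (μ + i * β) - Polynomial.C (1 - 2 * i * δ) * Polynomial.X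

lemma int_poly_exp {f : ℝ → ℝ} (hf : Measurable f) (c : ℝ) (hc : 0 < c)
    (hi : Integrable fun x => Real.exp (c * |x|) * f x) (p : Polynomial ℝ) :
    Integrable fun x => p.eval x * (Real.exp (c/2 * |x|) * f x) := by
  induction p using Polynomial.induction_on' with
  | add p r hp hr => simp only [Polynomial.eval_add, add_mul]; exact hp.add hr
  | monomial n a =>
    refine Integrable.mono' (g := fun x => (|a| * (n.factorial / (c/2)^n)) *
      ‖Real.exp (c * |x|) * f x‖) (hi.norm.const_mul _) (by
        apply Measurable.aestronglyMeasurable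
        apply Measurable.mul (Polynomial.continuous _).measurable
        fun_prop) (ae_of_all _ fun x => ?_)
    rw [Polynomial.eval_monomial, norm_mul, norm_mul, norm_mul, norm_mul, Real.norm_eq_abs a,
      Real.norm_of_nonneg (Real.exp_pos _).le, Real.norm_of_nonneg (Real.exp_pos _).le]
    have h1 := Real.pow_div_factorial_le_exp (c/2*|x|) (by positivity) n
    have h2 : ‖x^n‖ ≤ n.factorial / (c/2)^n * Real.exp (c/2*|x|) := by
      rw [norm_pow, Real.norm_eq_abs]
      rw [mul_pow, div_le_iff₀ (by exact_mod_cast n.factorial_pos)] at h1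
      rw [div_mul_eq_mul_div, le_div_iff₀ (by positivity)]
      linarith
    have h3 : Real.exp (c*|x|) = Real.exp (c/2*|x|) * Real.exp (c/2*|x|) := by
      rw [← Real.exp_add]; ring_nf
    rw [h3]
    calc |a| * ‖x^n‖ * (Real.exp (c/2*|x|) * ‖f x‖)
        ≤ |a| * (n.factorial / (c/2)^n * Real.exp (c/2*|x|)) * (Real.exp (c/2*|x|) * ‖f x‖) := by
          gcongr
      _ = _ := by ring

namespace PF
variable {f : ℝ → ℝ} {J : Set ℝ} {μ δ β γ : ℝ}

lemma int_poly_f (H : PF f J μ δ β γ) (p : Polynomial ℝ) : Integrable fun x => p.eval x * f x := by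
  obtain ⟨c, hc, hi⟩ := H.expint
  refine Integrable.mono (int_poly_exp H.fmeas c hc hi p) ?_ (ae_of_all _ fun x => ?_)
  · exact ((Polynomial.continuous _).measurable.mul H.fmeas).aestronglyMeasurable
  · rw [norm_mul, norm_mul, norm_mul, Real.norm_of_nonneg (Real.exp_pos _).le]
    gcongr
    have : 1 ≤ Real.exp (c/2*|x|) := Real.one_le_exp (by positivity)
    nlinarith [norm_nonneg (f x)]

lemma wt_eq (p : Polynomial ℝ) (i : ℕ) (x : ℝ) :
    p.eval x * wt f δ β γ i x = (p * Qp δ β γ ^ i).eval x * f x := by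
  simp [wt, Qp_eval, mul_assoc]

lemma int_poly (H : PF f J μ δ β γ) (i : ℕ) (p : Polynomial ℝ) :
    Integrable fun x => p.eval x * wt f δ β γ i x := by
  simp_rw [wt_eq]; exact H.int_poly_f _

lemma wt_meas (H : PF f J μ δ β γ) (i : ℕ) : Measurable (wt f δ β γ i) := by
  have := H.fmeas
  unfold wt pq
  fun_prop

lemma wt_pos (H : PF f J μ δ β γ) (i : ℕ) {x : ℝ} (hx : x ∈ J) : 0 < wt f δ β γ i x :=
  mul_pos (pow_pos (H.qpos x hx) i) (H.fpos x hx)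

lemma wt_zero (H : PF f J μ δ β γ) (i : ℕ) {x : ℝ} (hx : x ∉ J) : wt f δ β γ i x = 0 := by
  simp [wt, H.fzero x hx]

lemma wt_nn (H : PF f J μ δ β γ) (i : ℕ) (x : ℝ) : 0 ≤ wt f δ β γ i x := by
  by_cases hx : x ∈ J
  · exact (H.wt_pos i hx).le
  · exact (H.wt_zero i hx).ge

lemma idpoly (p : Polynomial ℝ) (i : ℕ) :
    (p * Qp δ β γ ^ i).derivative * Qp δ β γ + (p * Qp δ β γ ^ i) * (Polynomial.C μ - Polynomial.X)
      = (p.derivative * Qp δ β γ + p * ellp μ δ β i) * Qp δ β γ ^ i := by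
  have hQ : (Qp δ β γ).derivative = Polynomial.C (2 * δ) * Polynomial.X + Polynomial.C β := by
    simp [Qp]
    rw [show (Polynomial.C (2:ℝ)) = 2 from rfl]; ring
  rw [Polynomial.derivative_mul, Polynomial.derivative_pow, hQ]
  have e : ellp μ δ β i = Polynomial.C μ - Polynomial.X
    + (i : Polynomial ℝ) * (Polynomial.C (2 * δ) * Polynomial.X + Polynomial.C β) := by
    simp [ellp]; ring
  rw [e]
  rcases i with _ | i
  · simp
  · simp only [Nat.add_sub_cancel, map_natCast]
    push_cast
    ring

lemma lev1 (H : PF f J μ δ β γ) (i : ℕ) (p : Polynomial ℝ) (t : ℝ) :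
    ∫ x in Set.Iic t, (p.derivative * Qp δ β γ + p * ellp μ δ β i).eval x * wt f δ β γ i x
      = p.eval t * wt f δ β γ (i+1) t := by
  have := H.id1 (p * Qp δ β γ ^ i) t
  rw [idpoly] at this
  simp_rw [wt_eq]
  rw [this]
  simp only [Polynomial.eval_mul, Polynomial.eval_pow, Qp_eval]; ring

lemma lev0 (H : PF f J μ δ β γ) (i : ℕ) (p : Polynomial ℝ) :
    ∫ x, (p.derivative * Qp δ β γ + p * ellp μ δ β i).eval x * wt f δ β γ i x = 0 := by
  have := H.id0 (p * Qp δ β γ ^ i)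
  rw [idpoly] at this
  simp_rw [wt_eq]
  rw [this]

def cen (μ δ β : ℝ) (i : ℕ) : ℝ := (μ + i * β) / (1 - 2 * i * δ)

lemma den_pos (H : PF f J μ δ β γ) (i : ℕ) : 0 < 1 - 2 * i * δ := by
  have := H.hδ
  nlinarith [(Nat.cast_nonneg i : (0:ℝ) ≤ i)]

lemma cen_eq (H : PF f J μ δ β γ) (i : ℕ) (x : ℝ) : (cen μ δ β i - x) * wt f δ β γ i x =
    (1 - 2 * i * δ)⁻¹ * (((1:Polynomial ℝ).derivative * Qp δ β γ + 1 * ellp μ δ β i).eval x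
      * wt f δ β γ i x) := by
  have := H.den_pos i
  have h2 : (((1:Polynomial ℝ).derivative * Qp δ β γ + 1 * ellp μ δ β i).eval x)
      = (μ + i * β) - (1 - 2 * i * δ) * x := by simp [ellp]
  rw [h2, cen]
  generalize (1 - 2 * i * δ) = d at *
  field_simp

lemma cen_int (H : PF f J μ δ β γ) (i : ℕ) :
    Integrable fun x => (cen μ δ β i - x) * wt f δ β γ i x := by
  simp_rw [H.cen_eq]
  exact (H.int_poly i _).const_mul _

lemma cen1 (H : PF f J μ δ β γ) (i : ℕ) (t : ℝ) :
    ∫ x in Set.Iic t, (cen μ δ β i - x) * wt f δ β γ i x =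
      (1 - 2 * i * δ)⁻¹ * wt f δ β γ (i+1) t := by
  simp_rw [H.cen_eq]
  rw [integral_const_mul, H.lev1]; simp

lemma cen0 (H : PF f J μ δ β γ) (i : ℕ) :
    ∫ x, (cen μ δ β i - x) * wt f δ β γ i x = 0 := by
  simp_rw [H.cen_eq]
  rw [integral_const_mul, H.lev0]; simp

/-- An a.e. statement on weight. -/
lemma J_pos (H : PF f J μ δ β γ) : 0 < volume J := H.Jopen.measure_pos _ H.Jne

lemma not_ae (H : PF f J μ δ β γ) (c : ℝ) : ¬ ∀ᵐ x : ℝ, x ∈ J → x = c := by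
  intro h
  have h2 : ∀ᵐ x : ℝ, x ≠ c := by
    have := (Set.countable_singleton c).ae_notMem (volume : Measure ℝ)
    simpa using this
  have : ∀ᵐ x : ℝ, x ∉ J := by
    filter_upwards [h, h2] with x h1 h2 h3 using h2 (h1 h3)
  rw [ae_iff] at this
  simp at this
  exact H.J_pos.ne' this

lemma cen_mem (H : PF f J μ δ β γ) (i : ℕ) : cen μ δ β i ∈ J := by
  by_contra hc
  set c := cen μ δ β i
  have hcases : (∀ x ∈ J, x ≤ c) ∨ (∀ x ∈ J, c ≤ x) := by
    by_contra hcon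
    push Not at hcon
    obtain ⟨⟨x, hx, hx'⟩, y, hy, hy'⟩ := hcon
    exact hc (H.Jord.out hy hx ⟨hy'.le, hx'.le⟩)
  rcases hcases with h | h
  · have := (integral_eq_zero_iff_of_nonneg (μ := volume)
      (f := fun x => (c - x) * wt f δ β γ i x) (fun x => ?_) (H.cen_int i)).mp (H.cen0 i)
    · apply H.not_ae c
      filter_upwards [this] with x hx hxJ
      have := (H.wt_pos i hxJ).ne'
      simp [this] at hx
      linarith
    · by_cases hx : x ∈ J
      · exact mul_nonneg (by linarith [h x hx]) (H.wt_nn i x)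
      · simp [H.wt_zero i hx]
  · have := (integral_eq_zero_iff_of_nonneg (μ := volume)
      (f := fun x => -((c - x) * wt f δ β γ i x)) (fun x => ?_) (H.cen_int i).neg).mp (by
        rw [integral_neg, H.cen0 i, neg_zero])
    · apply H.not_ae c
      filter_upwards [this] with x hx hxJ
      have := (H.wt_pos i hxJ).ne'
      simp [this] at hx
      linarith
    · by_cases hx : x ∈ J
      · have := mul_nonneg (by linarith [h x hx] : 0 ≤ x - c) (H.wt_nn i x)
        simp only [Pi.zero_apply]; linarith
      · simp [H.wt_zero i hx]

/-- Weighted version: `L²` at level `i` and integration by parts. -/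
lemma level (H : PF f J μ δ β γ) (i : ℕ) (h hd : ℝ → ℝ) (hF : FTC J h hd)
    (hc : ContinuousOn h J) (hdm : AEStronglyMeasurable hd (volume.restrict J))
    (hInt : Integrable fun x => hd x ^ 2 * wt f δ β γ (i+1) x) :
    (Integrable fun x => h x ^ 2 * wt f δ β γ i x) ∧
    ((Integrable fun x => h x ^ 2 * wt f δ β γ i x) → ∀ p : Polynomial ℝ,
      ∫ x, hd x * (p.eval x * wt f δ β γ (i+1) x) =
      - ∫ x, h x * ((p.derivative * Qp δ β γ + p * ellp μ δ β i).eval x * wt f δ β γ i x)) := by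
  set c := cen μ δ β i with hcdef
  have hcJ : c ∈ J := H.cen_mem i
  have hJm : MeasurableSet J := H.Jopen.measurableSet
  obtain ⟨hd0, hd0m, hd0e⟩ : ∃ hd0 : ℝ → ℝ, Measurable hd0 ∧ ∀ᵐ x : ℝ, x ∈ J → hd x = hd0 x :=
    ⟨hdm.mk hd, hdm.stronglyMeasurable_mk.measurable,
      (ae_restrict_iff' hJm).mp hdm.ae_eq_mk⟩
  have key : ∀ x ∈ J, h x - h c = ∫ t in c..x, hd0 t := by
    intro x hx
    rw [(hF c hcJ x hx).2]
    apply intervalIntegral.integral_congr_ae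
    filter_upwards [hd0e] with t ht htm
    apply ht
    have := Set.uIoc_subset_uIcc htm
    exact H.Jord.uIcc_subset hcJ hx this
  have hInt0 : Integrable fun x => hd0 x ^ 2 * wt f δ β γ (i+1) x := by
    refine hInt.congr ?_
    filter_upwards [hd0e] with x hx
    by_cases hxJ : x ∈ J
    · rw [hx hxJ]
    · simp [H.wt_zero _ hxJ]
  have hw := H.wt_meas i
  have hden := H.den_pos i
  have hfin : ∫⁻ x, ENNReal.ofReal (wt f δ β γ i x) * (∫⁻ t in Set.uIoc c x, ‖hd0 t‖ₑ)^2 ≠ ∞ := by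
    refine ne_of_lt (lt_of_le_of_lt (poincare_core _ _ hd0 c hw (H.wt_nn i) hd0m (H.cen_int i)
      (H.cen1 i) (H.cen0 i)) ?_)
    have e : ∀ t, ‖hd0 t‖ₑ^2 * ENNReal.ofReal ((1 - 2 * i * δ)⁻¹ * wt f δ β γ (i+1) t) =
        ENNReal.ofReal ((1 - 2 * i * δ)⁻¹ * (hd0 t ^2 * wt f δ β γ (i+1) t)) := by
      intro t
      rw [Real.enorm_eq_ofReal_abs, ← ENNReal.ofReal_pow (abs_nonneg _),
        ← ENNReal.ofReal_mul (by positivity), sq_abs]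
      congr 1; ring
    simp_rw [e]
    exact (hInt0.const_mul _).lintegral_lt_top
  set h0 : ℝ → ℝ := J.indicator h with hh0
  have h0m : Measurable h0 := by
    refine measurable_of_restrict_of_restrict_compl hJm ?_ ?_
    · have : J.domRestrict h0 = J.domRestrict h := by ext x; simp [hh0]
      rw [this]
      exact hc.domRestrict.measurable
    · have : Jᶜ.domRestrict h0 = fun _ => 0 := by
        ext x; have := x.2; simp [hh0]; exact fun h => absurd h this
      rw [this]; exact measurable_const
  have one_int : Integrable (wt f δ β γ i) := by
    have := H.int_poly i 1; simpa using this
  have hwm := H.wt_meas i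
  have hm1 : Measurable fun x => (h0 x - h c) ^ 2 * wt f δ β γ i x := by fun_prop
  have int1 : Integrable fun x => (h0 x - h c) ^ 2 * wt f δ β γ i x := by
    refine ⟨hm1.aestronglyMeasurable, ?_⟩
    rw [hasFiniteIntegral_iff_enorm]
    refine lt_of_le_of_lt (lintegral_mono fun x => ?_) (lt_top_iff_ne_top.mpr hfin)
    by_cases hx : x ∈ J
    · have e1 : h0 x = h x := by simp [hh0, hx]
      rw [e1, key x hx, enorm_mul, enorm_pow, mul_comm,
        Real.enorm_eq_ofReal_abs (wt f δ β γ i x), abs_of_nonneg (H.wt_nn i x)]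
      gcongr
      rw [intervalIntegral.intervalIntegral_eq_integral_uIoc, enorm_smul]
      have : ‖(if c ≤ x then (1:ℝ) else -1)‖ₑ = 1 := by split_ifs <;> simp
      rw [this, one_mul]
      exact enorm_integral_le_lintegral_enorm _
    · simp [H.wt_zero i hx]
  have e0 : ∀ x, h x ^ 2 * wt f δ β γ i x = h0 x ^ 2 * wt f δ β γ i x := by
    intro x
    by_cases hx : x ∈ J
    · simp [hh0, hx]
    · simp [H.wt_zero i hx]
  refine ⟨?_, ?_⟩
  · simp_rw [e0]
    refine Integrable.mono' (g := fun x => 2 * ((h0 x - h c) ^ 2 * wt f δ β γ i x) +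
      2 * h c ^2 * wt f δ β γ i x) ((int1.const_mul 2).add (one_int.const_mul _))
      (by apply Measurable.aestronglyMeasurable; fun_prop) (ae_of_all _ fun x => ?_)
    have := H.wt_nn i x
    rw [Real.norm_of_nonneg (by positivity)]
    have : h0 x ^2 ≤ 2 * (h0 x - h c)^2 + 2 * h c ^2 := by nlinarith [sq_nonneg (h0 x - 2 * h c)]
    nlinarith
  · intro hInt2 p
    set φ := p.derivative * Qp δ β γ + p * ellp μ δ β i with hφ
    have hφ2 : Integrable fun x => (φ.eval x)^2 * wt f δ β γ i x := by
      have := H.int_poly i (φ^2)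
      simpa using this
    have ib := ibp_core (wt f δ β γ i) (fun x => φ.eval x) hd0
      (fun t => p.eval t * wt f δ β γ (i+1) t) c hw (H.wt_nn i) hd0m (Polynomial.continuous _).measurable hfin
      (H.int_poly i φ) hφ2 (H.lev1 i p) (H.lev0 i p)
    have r1 : ∫ x, hd x * (p.eval x * wt f δ β γ (i+1) x) =
        ∫ x, hd0 x * (p.eval x * wt f δ β γ (i+1) x) := by
      apply integral_congr_ae
      filter_upwards [hd0e] with x hx
      by_cases hxJ : x ∈ J
      · rw [hx hxJ]
      · simp [H.wt_zero _ hxJ]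
    rw [r1, ← neg_eq_iff_eq_neg, ← ib]
    have r2 : ∀ x, (∫ t in c..x, hd0 t) * (φ.eval x * wt f δ β γ i x) =
        h x * (φ.eval x * wt f δ β γ i x) - h c * (φ.eval x * wt f δ β γ i x) := by
      intro x
      by_cases hx : x ∈ J
      · rw [← key x hx]; ring
      · simp [H.wt_zero i hx]
    simp_rw [r2]
    rw [integral_sub, integral_const_mul, H.lev0, mul_zero, sub_zero]
    · have e3 : ∀ x, h x * (φ.eval x * wt f δ β γ i x) = h0 x * (φ.eval x * wt f δ β γ i x) := by
        intro x
        by_cases hx : x ∈ J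
        · simp [hh0, hx]
        · simp [H.wt_zero i hx]
      simp_rw [e3]
      simp_rw [e0] at hInt2
      refine Integrable.mono' (hInt2.add hφ2) (by
        apply Measurable.aestronglyMeasurable
        exact h0m.mul ((Polynomial.continuous _).measurable.mul hw)) (ae_of_all _ fun x => ?_)
      have := H.wt_nn i x
      simp only [Pi.add_apply]
      rw [norm_mul, norm_mul, Real.norm_of_nonneg this, Real.norm_eq_abs, Real.norm_eq_abs,
        ← sq_abs (h0 x), ← sq_abs (φ.eval x)]
      have : |h0 x| * |φ.eval x| ≤ |h0 x|^2 + |φ.eval x|^2 := by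
        nlinarith [sq_nonneg (|h0 x| - |φ.eval x|), abs_nonneg (h0 x), abs_nonneg (φ.eval x),
          sq_nonneg (|h0 x|), sq_nonneg (|φ.eval x|)]
      nlinarith
    · exact (H.int_poly i φ).const_mul _
end PF
end PartC

section PartD1
open scoped ENNReal

lemma quad_unbdd (δ β γ a : ℝ) (hδ : δ ≤ 0) (h : ∀ x, a ≤ x → 0 < pq δ β γ x) : δ = 0 ∧ 0 ≤ β := by
  have h0 : δ = 0 := by
    by_contra hne
    have hneg : δ < 0 := lt_of_le_of_ne hδ hne
    set x := max (max a 1) ((|β|+|γ|)/(-δ)) with hx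
    have h1 := h x (le_trans (le_max_left _ _) (le_max_left _ _))
    have h2 : 1 ≤ x := le_trans (le_max_right _ _) (le_max_left _ _)
    have h3 : (|β|+|γ|)/(-δ) ≤ x := le_max_right _ _
    rw [div_le_iff₀ (by linarith)] at h3
    unfold pq at h1
    have h4 : γ ≤ |γ| * x := by nlinarith [le_abs_self γ, abs_nonneg γ]
    have h5 : β * x ≤ |β| * x := by nlinarith [le_abs_self β]
    nlinarith
  refine ⟨h0, ?_⟩
  by_contra hb
  push Not at hb
  have h1 := h (max a (γ/(-β))) (le_max_left _ _)
  have h3 : γ/(-β) ≤ max a (γ/(-β)) := le_max_right _ _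
  rw [div_le_iff₀ (by linarith)] at h3
  unfold pq at h1
  rw [h0] at h1
  linarith

lemma right_tail (f : ℝ → ℝ) (J : Set ℝ) (μ δ β γ : ℝ) (hδ : δ ≤ 0) (fm : Measurable f)
    (fnn : ∀ x, 0 ≤ f x) (fi : Integrable f) (fz : ∀ x, x ∉ J → f x = 0)
    (Jord : J.OrdConnected) (Jne : J.Nonempty) (qpos : ∀ x ∈ J, 0 < pq δ β γ x)
    (hd : ∀ x ∈ J, HasDerivAt (fun x => pq δ β γ x * f x) ((μ - x) * f x) x) :
    ∃ c > 0, IntegrableOn (fun x => Real.exp (c * x) * f x) (Set.Ioi 0) := by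
  have bdd : ∀ (c M : ℝ), 0 < c → IntegrableOn (fun x => Real.exp (c * x) * f x) (Set.Iic M) := by
    intro c M hc
    refine Integrable.mono' (g := fun x => Real.exp (c * M) * f x) (fi.integrableOn.const_mul _)
      (by apply Measurable.aestronglyMeasurable; fun_prop) ?_
    rw [ae_restrict_iff' measurableSet_Iic]
    refine ae_of_all _ fun x hx => ?_
    rw [Real.norm_of_nonneg (mul_nonneg (Real.exp_pos _).le (fnn x))]
    have : x ≤ M := hx
    have := fnn x
    gcongr
  by_cases hb : BddAbove J
  · obtain ⟨M, hM⟩ := hb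
    refine ⟨1, one_pos, ?_⟩
    have h1 := bdd 1 M one_pos
    have h2 : IntegrableOn (fun x => Real.exp (1 * x) * f x) (Set.Ioi M) := by
      refine IntegrableOn.congr_fun (f := fun _ => 0) integrableOn_zero (fun x hx => ?_)
        measurableSet_Ioi
      have : x ∉ J := fun h => absurd (hM h) (not_le.mpr hx)
      simp [fz x this]
    have := h1.union h2
    rw [Set.Iic_union_Ioi] at this
    exact this.mono_set (Set.subset_univ _)
  · obtain ⟨a, ha⟩ := Jne
    have haJ : ∀ x, a ≤ x → x ∈ J := by
      intro x hx
      rw [not_bddAbove_iff] at hb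
      obtain ⟨y, hy, hxy⟩ := hb x
      exact Jord.out ha hy ⟨hx, hxy.le⟩
    obtain ⟨h0, hβ⟩ := quad_unbdd δ β γ a hδ (fun x hx => qpos x (haJ x hx))
    set c := 1 / (2 * (β + 1)) with hc
    have hcpos : 0 < c := by positivity
    have hcβ : c * β ≤ 1/2 := by
      rw [hc, div_mul_eq_mul_div, div_le_div_iff₀ (by positivity) (by positivity)]; linarith
    set x0 := max (max a 0) (2 * (c * γ + μ)) with hx0
    have hx0a : a ≤ x0 := le_trans (le_max_left _ _) (le_max_left _ _)
    have hx00 : 0 ≤ x0 := le_trans (le_max_right _ _) (le_max_left _ _)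
    have hx0c : 2 * (c * γ + μ) ≤ x0 := le_max_right _ _
    have hG : ∀ x ∈ Set.Ici x0, HasDerivAt (fun x => pq δ β γ x * f x * Real.exp (c * x))
        ((μ - x) * f x * Real.exp (c * x) + pq δ β γ x * f x * (Real.exp (c * x) * c)) x := by
      intro x hx
      refine (hd x (haJ x (hx0a.trans hx))).mul ?_
      have := ((hasDerivAt_id x).const_mul c).exp
      simpa using this
    have anti : AntitoneOn (fun x => pq δ β γ x * f x * Real.exp (c * x)) (Set.Ici x0) := by
      apply antitoneOn_of_deriv_nonpos (convex_Ici _)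
      · intro x hx; exact (hG x hx).continuousAt.continuousWithinAt
      · intro x hx; exact (hG x (interior_subset hx)).differentiableAt.differentiableWithinAt
      · intro x hx
        have hx' : x0 ≤ x := interior_subset hx
        rw [(hG x hx').deriv]
        have e : (μ - x) * f x * Real.exp (c * x) + pq δ β γ x * f x * (Real.exp (c * x) * c)
          = ((μ - x) + c * pq δ β γ x) * (f x * Real.exp (c * x)) := by ring
        rw [e]
        apply mul_nonpos_of_nonpos_of_nonneg
        · unfold pq; rw [h0]
          have : c * β * x ≤ 1/2 * x := mul_le_mul_of_nonneg_right hcβ (hx00.trans hx')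
          nlinarith
        · exact mul_nonneg (fnn x) (Real.exp_pos _).le
    set C := pq δ β γ x0 * f x0 * Real.exp (c * x0) with hC
    have hκ := qpos x0 (haJ x0 hx0a)
    have bound : ∀ x, x0 ≤ x → f x ≤ C / pq δ β γ x0 * Real.exp (- c * x) := by
      intro x hx
      have h1 : pq δ β γ x * f x * Real.exp (c * x) ≤ C := anti (Set.mem_Ici.mpr le_rfl) hx hx
      have h2 : pq δ β γ x0 ≤ pq δ β γ x := by
        unfold pq; rw [h0]; nlinarith
      have h3 : pq δ β γ x0 * f x * Real.exp (c * x) ≤ C := by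
        refine le_trans ?_ h1
        have := fnn x
        gcongr
      have h4 : Real.exp (-c * x) * Real.exp (c * x) = 1 := by
        rw [← Real.exp_add]; simp
      rw [div_mul_eq_mul_div, le_div_iff₀ hκ]
      calc f x * pq δ β γ x0 = (pq δ β γ x0 * f x * Real.exp (c * x)) * Real.exp (-c * x) := by
            linear_combination (- f x * pq δ β γ x0) * h4
        _ ≤ _ := by gcongr
    refine ⟨c/2, by positivity, ?_⟩
    have h1 := bdd (c/2) x0 (by positivity)
    have h2 : IntegrableOn (fun x => Real.exp (c/2 * x) * f x) (Set.Ioi x0) := by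
      refine Integrable.mono' (g := fun x => C / pq δ β γ x0 * Real.exp (-(c/2) * x))
        ((exp_neg_integrableOn_Ioi x0 (by positivity)).const_mul _)
        (by apply Measurable.aestronglyMeasurable; fun_prop) ?_
      rw [ae_restrict_iff' measurableSet_Ioi]
      refine ae_of_all _ fun x hx => ?_
      rw [Real.norm_of_nonneg (mul_nonneg (Real.exp_pos _).le (fnn x))]
      calc Real.exp (c/2*x) * f x ≤ Real.exp (c/2*x) * (C / pq δ β γ x0 * Real.exp (- c * x)) := by
            gcongr; exact bound x (le_of_lt hx)
        _ = C / pq δ β γ x0 * (Real.exp (c/2*x) * Real.exp (-c*x)) := by ring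
        _ = _ := by rw [← Real.exp_add]; congr 2; ring
    have := h1.union h2
    rw [Set.Iic_union_Ioi] at this
    exact this.mono_set (Set.subset_univ _)

lemma both_tail (f : ℝ → ℝ) (J : Set ℝ) (μ δ β γ : ℝ) (hδ : δ ≤ 0) (fm : Measurable f)
    (fnn : ∀ x, 0 ≤ f x) (fi : Integrable f) (fz : ∀ x, x ∉ J → f x = 0)
    (Jord : J.OrdConnected) (Jne : J.Nonempty) (qpos : ∀ x ∈ J, 0 < pq δ β γ x)
    (hd : ∀ x ∈ J, HasDerivAt (fun x => pq δ β γ x * f x) ((μ - x) * f x) x) :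
    ∃ c > 0, Integrable (fun x => Real.exp (c * |x|) * f x) := by
  obtain ⟨c1, hc1, h1⟩ := right_tail f J μ δ β γ hδ fm fnn fi fz Jord Jne qpos hd
  have qneg : ∀ x, pq δ (-β) γ x = pq δ β γ (-x) := fun x => by unfold pq; ring
  have hd2 : ∀ x ∈ {x | -x ∈ J}, HasDerivAt (fun x => pq δ (-β) γ x * f (-x))
      ((-μ - x) * f (-x)) x := by
    intro x hx
    have := (hd (-x) hx).scomp x (hasDerivAt_neg x)
    have e : (-μ - x) * f (-x) = (-1 : ℝ) • ((μ - -x) * f (-x)) := by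
      rw [neg_smul, one_smul]; ring
    rw [e]
    refine this.congr_of_eventuallyEq (Eventually.of_forall fun y => ?_)
    simp [qneg]
  obtain ⟨c2, hc2, h2⟩ := right_tail (fun x => f (-x)) {x | -x ∈ J} (-μ) δ (-β) γ hδ
    (by fun_prop) (fun x => fnn _) fi.comp_neg (fun x hx => fz _ hx)
    ⟨fun x hx y hy z hz => Jord.out hy hx ⟨by linarith [hz.2], by linarith [hz.1]⟩⟩
    (by obtain ⟨a, ha⟩ := Jne; exact ⟨-a, by simpa using ha⟩)
    (fun x hx => by rw [qneg]; exact qpos _ hx)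
    hd2
  refine ⟨min c1 c2, lt_min hc1 hc2, ?_⟩
  have a1 : IntegrableOn (fun x => Real.exp (min c1 c2 * |x|) * f x) (Set.Ioi 0) := by
    refine Integrable.mono' h1 (by apply Measurable.aestronglyMeasurable; fun_prop) ?_
    rw [ae_restrict_iff' measurableSet_Ioi]
    refine ae_of_all _ fun x hx => ?_
    have hx0 : 0 < x := hx
    rw [Real.norm_of_nonneg (mul_nonneg (Real.exp_pos _).le (fnn x)), abs_of_pos hx0]
    have := fnn x
    gcongr
    exact min_le_left _ _
  have a2 : IntegrableOn (fun x => Real.exp (min c1 c2 * |x|) * f x) (Set.Iic 0) := by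
    have h2' : IntegrableOn (fun x => Real.exp (c2 * (-x)) * f x) (Set.Iio 0) := by
      have := h2.comp_neg
      simpa using this
    rw [integrableOn_Iic_iff_integrableOn_Iio]
    refine Integrable.mono' h2' (by apply Measurable.aestronglyMeasurable; fun_prop) ?_
    rw [ae_restrict_iff' measurableSet_Iio]
    refine ae_of_all _ fun x hx => ?_
    have hx0 : x < 0 := hx
    rw [Real.norm_of_nonneg (mul_nonneg (Real.exp_pos _).le (fnn x)), abs_of_neg hx0]
    have := fnn x
    have : 0 ≤ -x := by linarith
    gcongr
    exact min_le_right _ _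
  have := a2.union a1
  rwa [Set.Iic_union_Ioi, integrableOn_univ] at this
end PartD1

section PartD2
open scoped ENNReal

lemma erealIoo_open (α ω : EReal) : IsOpen (erealIoo α ω) := by
  have h : erealIoo α ω = Real.toEReal ⁻¹' Set.Ioo α ω := rfl
  rw [h]; exact isOpen_Ioo.preimage continuous_coe_real_ereal

lemma erealIoo_ord (α ω : EReal) : (erealIoo α ω).OrdConnected :=
  ⟨fun x hx y hy z hz => ⟨lt_of_lt_of_le hx.1 (EReal.coe_le_coe_iff.mpr hz.1),
    lt_of_le_of_lt (EReal.coe_le_coe_iff.mpr hz.2) hy.2⟩⟩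

lemma pq_finite (δ β γ : ℝ) (h : 0 < |δ| + |β| + |γ|) : {x | pq δ β γ x = 0}.Finite := by
  have hne : Qp δ β γ ≠ 0 := by
    intro h0
    have h2 : (Qp δ β γ).coeff 2 = δ := by simp [Qp, Polynomial.coeff_X, Polynomial.coeff_C]
    have h1 : (Qp δ β γ).coeff 1 = β := by simp [Qp, Polynomial.coeff_X, Polynomial.coeff_C]
    have h3 : (Qp δ β γ).coeff 0 = γ := by simp [Qp, Polynomial.coeff_X, Polynomial.coeff_C]
    rw [h0] at h1 h2 h3
    simp at h1 h2 h3
    simp [← h1, ← h2, ← h3] at h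
  have := Polynomial.finite_setOfPred_isRoot hne
  refine this.subset fun x hx => ?_
  simp only [Set.mem_ofPred_eq, Polynomial.IsRoot, Qp_eval]; exact hx

/-- Basic facts extracted from the definition. -/
structure PF0 (f : ℝ → ℝ) (J : Set ℝ) (μ δ β γ : ℝ) : Prop where
  faem : AEMeasurable f
  fint : Integrable f
  hInt : Integrable fun x => (μ - x) * f x
  h0 : ∫ x, (μ - x) * f x = 0
  Jne : J.Nonempty
  eqF : ∀ x : ℝ, (∫ t in Set.Iic x, (μ - t) * f t) = pq δ β γ x * f x

lemma pf0 (P : Measure ℝ) (f : ℝ → ℝ) (μ δ β γ : ℝ) 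
    (hIP : IsIntegratedPearson P f μ δ β γ)
    (J : Set ℝ) (Jo : IsOpen J) (hsupp : {x : ℝ | 0 < f x} = J) : PF0 f J μ δ β γ := by
  obtain ⟨hP, fnn, hPd, hid, hμ, hq, hF⟩ := hIP
  have fz : ∀ x, x ∉ J → f x = 0 := by
    intro x hx
    rw [← hsupp] at hx
    exact le_antisymm (not_lt.mp hx) (fnn x)
  have Jm := Jo.measurableSet
  have Jne : J.Nonempty := by
    by_contra hne
    rw [Set.not_nonempty_iff_eq_empty] at hne
    have : ∀ x, f x = 0 := fun x => fz x (by simp [hne])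
    have h1 : P Set.univ = 1 := hP.measure_univ
    rw [hPd] at h1
    simp [this] at h1
  have inton : ∀ x ∈ J, IntegrableOn (fun t => (μ - t) * f t) (Set.Iic x) := by
    intro x hx
    by_contra hni
    have hz : ∀ y ∈ J, x ≤ y → pq δ β γ y = 0 := by
      intro y hy hxy
      have h1 := hF y
      rw [integral_undef (fun h => hni (IntegrableOn.mono_set h (Set.Iic_subset_Iic.mpr hxy)))] at h1
      have : 0 < f y := by rw [← hsupp] at hy; exact hy
      rcases mul_eq_zero.mp h1.symm with h | h
      · exact h
      · linarith
    obtain ⟨ε, hε, hb⟩ := Metric.isOpen_iff.mp Jo x hx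
    have : (Set.Ioo x (x+ε)).Finite := by
      refine (pq_finite δ β γ hq).subset fun y hy => hz y (hb ?_) hy.1.le
      rw [Metric.mem_ball, Real.dist_eq, abs_of_pos (by linarith [hy.1])]
      linarith [hy.2]
    exact Set.Ioo_infinite (by linarith) this
  have hm : AEStronglyMeasurable (fun t => (μ - t) * f t) := by
    have e : (fun t => (μ - t) * f t) = J.indicator (fun t => (μ - t) * f t) := by
      ext t
      by_cases ht : t ∈ J
      · simp [ht]
      · simp [ht, fz t ht]
    rw [e, aestronglyMeasurable_indicator_iff Jm]
    have hsub : J ⊆ ⋃ r : {r : ℚ // (r:ℝ) ∈ J}, Set.Iic ((r:ℚ):ℝ) := by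
      intro x hx
      obtain ⟨ε, hε, hb⟩ := Metric.isOpen_iff.mp Jo x hx
      obtain ⟨r, hr1, hr2⟩ := exists_rat_btwn (show x < x + ε by linarith)
      refine Set.mem_iUnion.mpr ⟨⟨r, hb ?_⟩, hr1.le⟩
      rw [Metric.mem_ball, Real.dist_eq, abs_of_pos (by linarith)]
      linarith
    refine AEStronglyMeasurable.mono_measure ?_ (Measure.restrict_mono_set _ hsub)
    rw [aestronglyMeasurable_iUnion_iff]
    intro r
    exact (inton _ r.2).aestronglyMeasurable
  have fm : AEMeasurable f := by
    have h1 : AEMeasurable fun t => ((μ - t) * f t) / (μ - t) := hm.aemeasurable.div (by fun_prop)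
    refine h1.congr ?_
    have h2 : ∀ᵐ x : ℝ, x ≠ μ := by
      have := (Set.countable_singleton μ).ae_notMem (volume : Measure ℝ)
      simpa using this
    filter_upwards [h2] with x hx
    have : μ - x ≠ 0 := sub_ne_zero.mpr hx.symm
    field_simp
  have h1 : ∫⁻ x, ENNReal.ofReal (f x) = 1 := by
    have h1 : P Set.univ = 1 := hP.measure_univ
    rw [hPd] at h1
    simpa using h1
  have fi : Integrable f := by
    refine ⟨fm.aestronglyMeasurable, ?_⟩
    rw [hasFiniteIntegral_iff_ofReal (ae_of_all _ fnn), h1]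
    exact ENNReal.one_lt_top
  have fi1 : ∫ x, f x = 1 := by
    rw [integral_eq_lintegral_of_nonneg_ae (ae_of_all _ fnn) fm.aestronglyMeasurable, h1]; rfl
  have hxi : Integrable fun x => f x * x := by
    rw [hPd, integrable_withDensity_iff_integrable_smul₀' fm.ennreal_ofReal (by simp)] at hid
    refine hid.congr (ae_of_all _ fun x => ?_)
    simp [ENNReal.toReal_ofReal (fnn x)]
  have hxμ : ∫ x, f x * x = μ := by
    rw [hμ, hPd, integral_withDensity_eq_integral_toReal_smul₀ fm.ennreal_ofReal (by simp)]
    congr 1; ext x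
    simp [ENNReal.toReal_ofReal (fnn x)]
  have e : (fun x => (μ - x) * f x) = fun x => μ * f x - f x * x := by ext x; ring
  refine ⟨fm, fi, ?_, ?_, Jne, hF⟩
  · rw [e]; exact (fi.const_mul _).sub hxi
  · rw [e, integral_sub (fi.const_mul _) hxi, integral_const_mul, fi1, hxμ]; ring

lemma F_pos {f : ℝ → ℝ} {J : Set ℝ} {μ δ β γ : ℝ} (H : PF0 f J μ δ β γ) (fnn : ∀ x, 0 ≤ f x)
    (fpos : ∀ x ∈ J, 0 < f x) (Jo : IsOpen J) (x : ℝ) (hx : x ∈ J) :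
    0 < ∫ t in Set.Iic x, (μ - t) * f t := by
  obtain ⟨ε, hε, hb⟩ := Metric.isOpen_iff.mp Jo x hx
  rcases le_or_gt x μ with h | h
  · rw [setIntegral_pos_iff_support_of_nonneg_ae _ H.hInt.integrableOn]
    · have : Set.Ioo (x - ε) x ⊆
          (Function.support fun t => (μ - t) * f t) ∩ Set.Iic x := by
        intro t ht
        refine ⟨?_, ht.2.le⟩
        have htJ : t ∈ J := hb (by
          rw [Metric.mem_ball, Real.dist_eq, abs_of_neg (by linarith [ht.2])]; linarith [ht.1])
        exact (mul_pos (by linarith [ht.2]) (fpos t htJ)).ne'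
      refine lt_of_lt_of_le ?_ (measure_mono this)
      simp [hε]
    · filter_upwards [ae_restrict_mem measurableSet_Iic] with t ht
      exact mul_nonneg (by have : t ≤ x := ht; linarith) (fnn t)
  · have hs := intervalIntegral.integral_Iic_add_Ioi (b := x) H.hInt.integrableOn
      H.hInt.integrableOn
    rw [H.h0] at hs
    have : 0 < ∫ t in Set.Ioi x, (t - μ) * f t := by
      have hi : Integrable fun t => (t - μ) * f t := by
        refine H.hInt.neg.congr (ae_of_all _ fun t => ?_)
        simp only [Pi.neg_apply]; ring
      rw [setIntegral_pos_iff_support_of_nonneg_ae _ hi.integrableOn]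
      · have : Set.Ioo x (x + ε) ⊆
            (Function.support fun t => (t - μ) * f t) ∩ Set.Ioi x := by
          intro t ht
          refine ⟨?_, ht.1⟩
          have htJ : t ∈ J := hb (by
            rw [Metric.mem_ball, Real.dist_eq, abs_of_pos (by linarith [ht.1])]; linarith [ht.2])
          exact (mul_pos (by linarith [ht.1]) (fpos t htJ)).ne'
        refine lt_of_lt_of_le ?_ (measure_mono this)
        simp [hε]
      · filter_upwards [ae_restrict_mem measurableSet_Ioi] with t ht
        exact mul_nonneg (by have : x < t := ht; linarith) (fnn t)
    have e : ∫ t in Set.Ioi x, (μ - t) * f t = - ∫ t in Set.Ioi x, (t - μ) * f t := by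
      rw [← integral_neg]; congr 1; ext t; ring
    rw [e] at hs
    linarith

lemma pf_of_IP (P : Measure ℝ) (f : ℝ → ℝ) (μ δ β γ : ℝ) (hδ : δ ≤ 0)
    (hIP : IsIntegratedPearson P f μ δ β γ)
    (α ω : EReal) (hsupp : {x : ℝ | 0 < f x} = erealIoo α ω) :
    PF f (erealIoo α ω) μ δ β γ := by
  set J := erealIoo α ω with hJ
  have Jo : IsOpen J := erealIoo_open α ω
  have Jord : J.OrdConnected := erealIoo_ord α ω
  have H := pf0 P f μ δ β γ hIP J Jo hsupp
  have fnn := hIP.2.1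
  have fz : ∀ x, x ∉ J → f x = 0 := by
    intro x hx
    rw [← hsupp] at hx
    exact le_antisymm (not_lt.mp hx) (fnn x)
  have fpos : ∀ x ∈ J, 0 < f x := by
    intro x hx; rw [← hsupp] at hx; exact hx
  have Jm := Jo.measurableSet
  set F : ℝ → ℝ := fun x => pq δ β γ x * f x with hFdef
  have Fpos : ∀ x ∈ J, 0 < F x := by
    intro x hx
    have := F_pos H fnn fpos Jo x hx
    rwa [H.eqF x] at this
  have qpos : ∀ x ∈ J, 0 < pq δ β γ x := fun x hx =>
    (pos_iff_pos_of_mul_pos (Fpos x hx)).mpr (fpos x hx)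
  have Feq : ∀ a x, F x = F a + ∫ t in a..x, (μ - t) * f t := by
    intro a x
    rw [← intervalIntegral.integral_Iic_sub_Iic H.hInt.integrableOn H.hInt.integrableOn,
      H.eqF, H.eqF]
    simp [hFdef]
  have Fcont : Continuous F := by
    have : F = fun x => F 0 + ∫ t in (0:ℝ)..x, (μ - t) * f t := by ext x; exact Feq 0 x
    rw [this]
    exact continuous_const.add
      (intervalIntegral.continuous_primitive (fun a b => H.hInt.intervalIntegrable) 0)
  have qcont : Continuous (pq δ β γ) := by unfold pq; fun_prop
  have fe : ∀ x ∈ J, f x = F x / pq δ β γ x := by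
    intro x hx
    have := (qpos x hx).ne'
    simp only [hFdef]; field_simp
  have fm : Measurable f := by
    have : f = J.indicator fun x => F x / pq δ β γ x := by
      ext x
      by_cases hx : x ∈ J
      · rw [Set.indicator_of_mem hx, fe x hx]
      · rw [Set.indicator_of_notMem hx, fz x hx]
    rw [this]
    exact (Fcont.measurable.div qcont.measurable).indicator Jm
  have fcont : ∀ x ∈ J, ContinuousAt f x := by
    intro x hx
    have h1 : ContinuousAt (fun x => F x / pq δ β γ x) x :=
      Fcont.continuousAt.div qcont.continuousAt (qpos x hx).ne'
    refine h1.congr ?_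
    filter_upwards [Jo.mem_nhds hx] with y hy using (fe y hy).symm
  have Fd : ∀ x ∈ J, HasDerivAt F ((μ - x) * f x) x := by
    intro x hx
    have : F = fun y => F 0 + ∫ t in (0:ℝ)..y, (μ - t) * f t := by ext x; exact Feq 0 x
    rw [this]
    refine HasDerivAt.const_add _ ?_
    refine intervalIntegral.integral_hasDerivAt_right H.hInt.intervalIntegrable ?_ ?_
    · exact ⟨Set.univ, univ_mem, by rw [Measure.restrict_univ]; exact H.hInt.aestronglyMeasurable⟩
    · exact (by fun_prop : ContinuousAt (fun t => μ - t) x).mul (fcont x hx)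
  obtain ⟨c, hc, he⟩ := both_tail f J μ δ β γ hδ fm fnn H.fint fz Jord H.Jne qpos Fd
  have ipf : ∀ p : Polynomial ℝ, Integrable fun x => p.eval x * f x := by
    intro p
    refine Integrable.mono (int_poly_exp fm c hc he p) ?_ (ae_of_all _ fun x => ?_)
    · exact ((Polynomial.continuous _).measurable.mul fm).aestronglyMeasurable
    · rw [norm_mul, norm_mul, norm_mul, Real.norm_of_nonneg (Real.exp_pos _).le]
      gcongr
      have : 1 ≤ Real.exp (c/2*|x|) := Real.one_le_exp (by positivity)
      nlinarith [norm_nonneg (f x)]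
  have Bc : {x : ℝ | (x : EReal) = α ∨ (x : EReal) = ω}.Countable := by
    have : {x : ℝ | (x : EReal) = α ∨ (x : EReal) = ω} =
      {x : ℝ | (x : EReal) = α} ∪ {x : ℝ | (x : EReal) = ω} := rfl
    rw [this]
    refine Set.Countable.union (Set.Subsingleton.countable ?_) (Set.Subsingleton.countable ?_)
    · intro x hx y hy
      exact EReal.coe_injective (hx.trans hy.symm)
    · intro x hx y hy
      exact EReal.coe_injective (hx.trans hy.symm)
  have key : ∀ (s : Polynomial ℝ) (a b : ℝ), ∫ x in a..b,
      (s.derivative * Qp δ β γ + s * (Polynomial.C μ - Polynomial.X)).eval x * f x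
      = s.eval b * F b - s.eval a * F a := by
    intro s a b
    refine integral_eq_of_hasDerivAt_off_countable (fun x => s.eval x * F x) _ Bc
      (s.continuous.mul Fcont).continuousOn ?_ (ipf _).intervalIntegrable
    rintro x ⟨-, hx⟩
    by_cases hxJ : x ∈ J
    · have h1 := (s.hasDerivAt x).mul (Fd x hxJ)
      have e : (s.derivative * Qp δ β γ + s * (Polynomial.C μ - Polynomial.X)).eval x * f x =
          s.derivative.eval x * F x + s.eval x * ((μ - x) * f x) := by
        simp only [Polynomial.eval_add, Polynomial.eval_mul, Polynomial.eval_sub,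
          Polynomial.eval_C, Polynomial.eval_X, Qp_eval, hFdef]
        ring
      simp only [e]
      exact h1
    · have hev : ∀ᶠ y in nhds x, f y = 0 := by
        have hor : (x : EReal) < α ∨ ω < (x : EReal) := by
          simp only [Set.mem_ofPred_eq, not_or] at hx
          by_contra hcon
          push Not at hcon
          exact hxJ ⟨lt_of_le_of_ne hcon.1 (Ne.symm hx.1), lt_of_le_of_ne hcon.2 hx.2⟩
        rcases hor with h | h
        · have : ∀ᶠ y : ℝ in nhds x, (y : EReal) < α :=
            continuous_coe_real_ereal.continuousAt.eventually (Iio_mem_nhds h)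
          filter_upwards [this] with y hy
          exact fz y fun h => absurd h.1 (not_lt.mpr hy.le)
        · have : ∀ᶠ y : ℝ in nhds x, ω < (y : EReal) :=
            continuous_coe_real_ereal.continuousAt.eventually (Ioi_mem_nhds h)
          filter_upwards [this] with y hy
          exact fz y fun h => absurd h.2 (not_lt.mpr hy.le)
      rw [fz x hxJ, mul_zero]
      refine (hasDerivAt_const x (0:ℝ)).congr_of_eventuallyEq ?_
      filter_upwards [hev] with y hy
      simp [hFdef, hy]
  have Gint : ∀ s : Polynomial ℝ, Integrable fun x => s.eval x * F x := by
    intro s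
    refine (ipf (s * Qp δ β γ)).congr (ae_of_all _ fun x => ?_)
    simp [Qp_eval, hFdef, mul_assoc]
  have id1 : ∀ (s : Polynomial ℝ) (t : ℝ), ∫ x in Set.Iic t,
    (s.derivative * Qp δ β γ + s * (Polynomial.C μ - Polynomial.X)).eval x * f x
      = s.eval t * F t := by
    intro s t
    have h1 := intervalIntegral_tendsto_integral_Iic (l := atBot) (a := id) t
      (ipf (s.derivative * Qp δ β γ + s * (Polynomial.C μ - Polynomial.X))).integrableOn tendsto_id
    simp only [key, id] at h1
    have h2 := (tendsto_const_nhds (x := s.eval t * F t)).sub h1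
    simp only [sub_sub_cancel] at h2
    have := IntegrableAtFilter.eq_zero_of_tendsto ((Gint s).integrableAtFilter atBot) (by
      intro u hu
      obtain ⟨a, ha⟩ := mem_atBot_sets.mp hu
      refine top_unique ?_
      rw [← Real.volume_Iic (a := a)]
      exact measure_mono ha) h2
    linarith
  refine ⟨hδ, fm, fnn, fpos, fz, Jo, Jord, H.Jne, qpos, ⟨c, hc, he⟩, ?_, ?_⟩
  · intro s t
    rw [id1 s t]; simp [hFdef, mul_assoc]
  · intro s
    have h1 := (aecover_Iic (μ := (volume : Measure ℝ)) (l := atTop) (b := id)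
      tendsto_id).integral_tendsto_of_countably_generated
      (ipf (s.derivative * Qp δ β γ + s * (Polynomial.C μ - Polynomial.X)))
    simp only [id, id1] at h1
    exact IntegrableAtFilter.eq_zero_of_tendsto ((Gint s).integrableAtFilter atTop) (by
      intro u hu
      obtain ⟨a, ha⟩ := mem_atTop_sets.mp hu
      refine top_unique ?_
      rw [← Real.volume_Ici (a := a)]
      exact measure_mono ha) h1
end PartD2

section PartF1
open scoped ENNReal

lemma mem_int_expset (ν : Measure ℝ) (c : ℝ)
    (h : Integrable (fun x => Real.exp (c * |x|)) ν) {t : ℝ} (ht : t ∈ Set.Ioo (-c) c) :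
    t ∈ interior (integrableExpSet id ν) := by
  refine interior_maximal ?_ isOpen_Ioo ht
  intro s hs
  refine Integrable.mono' h (by apply Measurable.aestronglyMeasurable; fun_prop)
    (ae_of_all _ fun x => ?_)
  rw [Real.norm_of_nonneg (Real.exp_pos _).le]
  apply Real.exp_le_exp.mpr
  have : |s| ≤ c := abs_le.mpr ⟨hs.1.le, hs.2.le⟩
  calc s * id x ≤ |s * x| := le_abs_self _
    _ = |s| * |x| := abs_mul _ _
    _ ≤ c * |x| := by gcongr

lemma moment_det (ν1 ν2 : Measure ℝ) [IsFiniteMeasure ν1] [IsFiniteMeasure ν2] (c : ℝ) (hc : 0 < c)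
    (h1 : Integrable (fun x => Real.exp (c * |x|)) ν1)
    (h2 : Integrable (fun x => Real.exp (c * |x|)) ν2)
    (hm : ∀ n : ℕ, ∫ x, x ^ n ∂ν1 = ∫ x, x ^ n ∂ν2) : ν1 = ν2 := by
  set S : Set ℂ := Complex.reLm ⁻¹' Set.Ioo (-c) c with hS
  have an : ∀ (ν : Measure ℝ), Integrable (fun x => Real.exp (c * |x|)) ν →
      AnalyticOnNhd ℂ (complexMGF id ν) S := by
    intro ν h z hz
    exact analyticAt_complexMGF (mem_int_expset ν c h hz)
  have hz0 : (0:ℂ) ∈ S := by simp [hS, hc]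
  have hder : ∀ (ν : Measure ℝ), Integrable (fun x => Real.exp (c * |x|)) ν → ∀ n,
      iteratedDeriv n (complexMGF id ν) 0 = ((∫ x, x ^ n ∂ν : ℝ) : ℂ) := by
    intro ν h n
    rw [iteratedDeriv_complexMGF (mem_int_expset ν c h (by simpa using hc)), ← integral_complex_ofReal]
    simp
  have hev : complexMGF id ν1 =ᶠ[nhds 0] complexMGF id ν2 := by
    have p1 := (an ν1 h1 0 hz0).hasFPowerSeriesAt
    have p2 := (an ν2 h2 0 hz0).hasFPowerSeriesAt
    simp only [hder ν1 h1, hder ν2 h2, hm] at p1 p2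
    have p3 := p1.sub p2
    rw [sub_self] at p3
    filter_upwards [p3.eventually_eq_zero] with z hz
    exact sub_eq_zero.mp hz
  have heq := AnalyticOnNhd.eqOn_of_preconnected_of_eventuallyEq (an ν1 h1) (an ν2 h2)
    ((convex_Ioo (-c) c).linear_preimage Complex.reLm).isPreconnected hz0 hev
  apply Measure.ext_of_charFun
  ext t
  rw [← complexMGF_id_mul_I, ← complexMGF_id_mul_I]
  exact heq (by simp [hS, hc])

lemma complete_poly (ν : Measure ℝ) [IsFiniteMeasure ν] (c : ℝ) (hc : 0 < c)
    (h : Integrable (fun x => Real.exp (c * |x|)) ν) (u : ℝ → ℝ) (hu : MemLp u 2 ν)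
    (h0 : ∀ n : ℕ, ∫ x, u x * x ^ n ∂ν = 0) : u =ᵐ[ν] 0 := by
  have um := hu.aestronglyMeasurable.aemeasurable
  have uint : Integrable u ν := hu.integrable (by norm_num)
  have hu2 : Integrable (fun x => u x ^ 2) ν := hu.integrable_sq
  have eint : Integrable (fun x => u x * Real.exp (c/2 * |x|)) ν := by
    refine Integrable.mono' (hu2.add h) (um.mul (by fun_prop)).aestronglyMeasurable
      (ae_of_all _ fun x => ?_)
    simp only [Pi.add_apply]
    have e : Real.exp (c * |x|) = Real.exp (c/2*|x|) ^ 2 := by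
      rw [← Real.exp_nat_mul]; congr 1; push_cast; ring
    rw [e, norm_mul, Real.norm_of_nonneg (Real.exp_pos _).le, Real.norm_eq_abs, ← sq_abs (u x)]
    have := Real.exp_pos (c/2*|x|)
    nlinarith [sq_nonneg (|u x| - Real.exp (c/2*|x|)), abs_nonneg (u x), sq_nonneg (|u x|),
      sq_nonneg (Real.exp (c/2*|x|))]
  have xint : ∀ n : ℕ, Integrable (fun x => u x * x ^ n) ν := by
    intro n
    have hK : ∀ x : ℝ, |x| ^ n ≤ n.factorial / (c/2)^n * Real.exp (c/2*|x|) := by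
      intro x
      have h1 := Real.pow_div_factorial_le_exp (c/2*|x|) (by positivity) n
      rw [mul_pow, div_le_iff₀ (by exact_mod_cast n.factorial_pos)] at h1
      rw [div_mul_eq_mul_div, le_div_iff₀ (by positivity)]
      linarith
    refine Integrable.mono' (eint.norm.const_mul (n.factorial / (c/2)^n))
      (um.mul (by fun_prop)).aestronglyMeasurable (ae_of_all _ fun x => ?_)
    rw [norm_mul, norm_mul, norm_pow, Real.norm_of_nonneg (Real.exp_pos _).le,
      Real.norm_eq_abs x]
    calc ‖u x‖ * |x|^n ≤ ‖u x‖ * (n.factorial / (c/2)^n * Real.exp (c/2*|x|)) := by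
          gcongr; exact hK x
      _ = _ := by ring
  -- the positive and negative part measures
  have gen : ∀ v : ℝ → ℝ, AEMeasurable v ν → (∀ x, |v x| ≤ |u x|) →
      IsFiniteMeasure (ν.withDensity fun x => ENNReal.ofReal (v x)) ∧
      Integrable (fun x => Real.exp (c/2 * |x|)) (ν.withDensity fun x => ENNReal.ofReal (v x)) ∧
      ∀ n : ℕ, (∫ x, x ^ n ∂(ν.withDensity fun x => ENNReal.ofReal (v x)) =
        ∫ x, max (v x) 0 * x ^ n ∂ν) ∧ Integrable (fun x => max (v x) 0 * x ^ n) ν := by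
    intro v vm hv
    have hmax : ∀ x, |max (v x) 0| ≤ |u x| := fun x => by
      refine le_trans ?_ (hv x)
      rcases le_total (v x) 0 with h | h <;> simp [h]
    have vint : Integrable v ν := uint.mono vm.aestronglyMeasurable (ae_of_all _ fun x => hv x)
    have tr : ∀ x, (ENNReal.ofReal (v x)).toReal = max (v x) 0 := fun x => ENNReal.toReal_ofReal'
    refine ⟨isFiniteMeasure_withDensity_ofReal vint.2, ?_, fun n => ⟨?_, ?_⟩⟩
    · rw [integrable_withDensity_iff_integrable_smul₀' vm.ennreal_ofReal (by simp)]
      simp only [tr, smul_eq_mul]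
      refine eint.mono ((vm.max aemeasurable_const).mul (by fun_prop)).aestronglyMeasurable
        (ae_of_all _ fun x => ?_)
      rw [norm_mul, norm_mul]
      gcongr
      exact hmax x
    · rw [integral_withDensity_eq_integral_toReal_smul₀ vm.ennreal_ofReal (by simp)]
      simp only [tr, smul_eq_mul]
    · refine (xint n).mono ((vm.max aemeasurable_const).mul (by fun_prop)).aestronglyMeasurable
        (ae_of_all _ fun x => ?_)
      rw [norm_mul, norm_mul]
      gcongr
      exact hmax x
  obtain ⟨f1, e1, m1⟩ := gen u um (fun x => le_rfl)
  obtain ⟨f2, e2, m2⟩ := gen (fun x => - u x) um.neg (fun x => (abs_neg _).le)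
  have hmm : ∀ x, max (u x) 0 - max (-u x) 0 = u x := by
    intro x
    rcases le_total (u x) 0 with h | h
    · rw [max_eq_right h, max_eq_left (by linarith)]; ring
    · rw [max_eq_left h, max_eq_right (by linarith)]; ring
  have hmom : ∀ n : ℕ, ∫ x, x ^ n ∂(ν.withDensity fun x => ENNReal.ofReal (u x)) =
      ∫ x, x ^ n ∂(ν.withDensity fun x => ENNReal.ofReal (-u x)) := by
    intro n
    rw [(m1 n).1, (m2 n).1, ← sub_eq_zero, ← integral_sub (m1 n).2 (m2 n).2]
    refine Eq.trans ?_ (h0 n)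
    congr 1; ext x
    rw [← sub_mul, hmm]
  have heq := moment_det _ _ (c/2) (by positivity) e1 e2 hmom
  have hneg : AEMeasurable (fun x => ENNReal.ofReal (-u x)) ν := um.neg.ennreal_ofReal
  rw [withDensity_eq_iff_of_sigmaFinite um.ennreal_ofReal hneg] at heq
  filter_upwards [heq] with x hx
  have := congrArg ENNReal.toReal hx
  rw [ENNReal.toReal_ofReal', ENNReal.toReal_ofReal'] at this
  simp only [Pi.zero_apply]
  rcases le_total (u x) 0 with h | h
  · simp [h] at this; linarith
  · simp [h] at this; linarith
end PartF1

section PartF2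
open scoped ENNReal

lemma L2_inner_toLp {ν : Measure ℝ} {u v : ℝ → ℝ} (hu : MemLp u 2 ν) (hv : MemLp v 2 ν) :
    inner ℝ (hu.toLp u) (hv.toLp v) = ∫ x, u x * v x ∂ν := by
  rw [L2.inner_def]
  apply integral_congr_ae
  filter_upwards [hu.coeFn_toLp, hv.coeFn_toLp] with x h1 h2
  rw [h1, h2]; simp [mul_comm]

lemma parseval (w : ℝ → ℝ) (wm : Measurable w) (wnn : ∀ x, 0 ≤ w x) (c : ℝ) (hc : 0 < c)
    (he : Integrable fun x => Real.exp (c * |x|) * w x)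
    (ψ : ℕ → Polynomial ℝ) (hdeg : ∀ k, (ψ k).degree = k)
    (orth : ∀ j k, j ≠ k → ∫ x, (ψ j).eval x * ((ψ k).eval x * w x) = 0)
    (N : ℕ → ℝ) (hN : ∀ k, 0 < N k)
    (hNe : ∀ k, ∫ x, (ψ k).eval x * ((ψ k).eval x * w x) = N k)
    (h : ℝ → ℝ) (hm : Measurable h) (hh : Integrable fun x => h x ^ 2 * w x) :
    HasSum (fun k => (∫ x, h x * ((ψ k).eval x * w x)) ^ 2 / N k) (∫ x, h x ^ 2 * w x) := by
  set ν : Measure ℝ := volume.withDensity fun x => ENNReal.ofReal (w x) with hν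
  have I1 : ∀ g : ℝ → ℝ, ∫ x, g x ∂ν = ∫ x, g x * w x := by
    intro g
    rw [hν, integral_withDensity_eq_integral_toReal_smul wm.ennreal_ofReal (by simp)]
    congr 1; ext x
    rw [ENNReal.toReal_ofReal (wnn x), smul_eq_mul, mul_comm]
  have I2 : ∀ g : ℝ → ℝ, Integrable g ν ↔ Integrable fun x => g x * w x := by
    intro g
    rw [hν, integrable_withDensity_iff wm.ennreal_ofReal (by simp)]
    simp only [ENNReal.toReal_ofReal (wnn _)]
  have pint : ∀ p : Polynomial ℝ, Integrable (fun x => p.eval x) ν := by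
    intro p
    rw [I2]
    refine Integrable.mono (int_poly_exp wm c hc he p) ?_ (ae_of_all _ fun x => ?_)
    · exact ((Polynomial.continuous _).measurable.mul wm).aestronglyMeasurable
    · rw [norm_mul, norm_mul, norm_mul, Real.norm_of_nonneg (Real.exp_pos _).le]
      gcongr
      have : 1 ≤ Real.exp (c/2*|x|) := Real.one_le_exp (by positivity)
      nlinarith [norm_nonneg (w x)]
  have fin : IsFiniteMeasure ν := by
    have := pint 1
    simp only [Polynomial.eval_one] at this
    rcases integrable_const_iff.mp this with h | h
    · norm_num at h
    · exact h
  have pL : ∀ p : Polynomial ℝ, MemLp (fun x => p.eval x) 2 ν := by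
    intro p
    rw [memLp_two_iff_integrable_sq p.continuous.measurable.aestronglyMeasurable]
    have := pint (p^2)
    simpa using this
  have hL : MemLp h 2 ν := by
    rw [memLp_two_iff_integrable_sq hm.aestronglyMeasurable, I2]
    exact hh
  have heν : Integrable (fun x => Real.exp (c * |x|)) ν := by rw [I2]; exact he
  set b : ℕ → Lp ℝ 2 ν := fun k => (√(N k))⁻¹ • (pL (ψ k)).toLp _ with hb
  have ib : ∀ (k : ℕ) (u : ℝ → ℝ) (hu : MemLp u 2 ν), inner ℝ (hu.toLp u) (b k) =
      (√(N k))⁻¹ * ∫ x, u x * ((ψ k).eval x * w x) := by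
    intro k u hu
    rw [hb]
    simp only
    rw [inner_smul_right, L2_inner_toLp, I1]
    simp only [mul_assoc]
  have on : Orthonormal ℝ b := by
    rw [orthonormal_iff_ite]
    intro j k
    have : inner ℝ (b j) (b k) = (√(N j))⁻¹ * inner ℝ ((pL (ψ j)).toLp _) (b k) := by
      exact real_inner_smul_left _ _ _
    rw [this, ib]
    split_ifs with hjk
    · subst hjk
      rw [hNe]
      have := Real.mul_self_sqrt (hN j).le
      have h2 : √(N j) ≠ 0 := (Real.sqrt_pos.mpr (hN j)).ne'
      field_simp
      nlinarith
    · rw [orth j k hjk]; simp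
  let S : Polynomial.Sequence ℝ := ⟨ψ, hdeg⟩
  have hspan : Submodule.span ℝ (Set.range ψ) = ⊤ := by
    refine S.span fun i => ?_
    rw [isUnit_iff_ne_zero, Polynomial.leadingCoeff_ne_zero]
    intro h0
    have h1 := hdeg i
    have : ψ i = 0 := h0
    rw [this] at h1
    simp at h1
  have hbot : (Submodule.span ℝ (Set.range b))ᗮ = ⊥ := by
    rw [Submodule.eq_bot_iff]
    intro u hu
    have hu1 : ∀ k, inner ℝ u (b k) = 0 := fun k => by
      rw [real_inner_comm]
      exact (Submodule.mem_orthogonal _ _).mp hu _ (Submodule.subset_span ⟨k, rfl⟩)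
    have uL : MemLp u 2 ν := Lp.memLp u
    have huv : ∀ p : Polynomial ℝ, ∫ x, u x * p.eval x ∂ν = 0 := by
      intro p
      have hp : p ∈ Submodule.span ℝ (Set.range ψ) := by rw [hspan]; trivial
      have mi : ∀ p : Polynomial ℝ, Integrable (fun x => u x * p.eval x) ν :=
        fun p => uL.integrable_mul (pL p)
      induction hp using Submodule.span_induction with
      | mem p hp =>
        obtain ⟨k, rfl⟩ := hp
        have h1 := hu1 k
        rw [show u = uL.toLp u from (Lp.toLp_coeFn u uL).symm, ib] at h1
        rcases mul_eq_zero.mp h1 with h2 | h2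
        · exact absurd h2 (inv_ne_zero (Real.sqrt_pos.mpr (hN k)).ne')
        · rw [I1]; simp only [mul_assoc]; exact h2
      | zero => simp
      | add p r _ _ hp hr =>
        simp only [Polynomial.eval_add, mul_add]
        rw [integral_add (mi p) (mi r), hp, hr, add_zero]
      | smul a p _ hp =>
        simp only [Polynomial.eval_smul, smul_eq_mul, mul_left_comm _ a]
        rw [integral_const_mul, hp, mul_zero]
    have := complete_poly ν c hc heν u uL (fun n => by
      have := huv (Polynomial.X ^ n)
      simpa using this)
    exact (Lp.eq_zero_iff_ae_eq_zero).mpr this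
  have hs := (HilbertBasis.mkOfOrthogonalEqBot on hbot).hasSum_inner_mul_inner
    (hL.toLp h) (hL.toLp h)
  rw [HilbertBasis.coe_mkOfOrthogonalEqBot, L2_inner_toLp, I1] at hs
  have e1 : ∀ x, h x * h x * w x = h x ^ 2 * w x := fun x => by ring
  simp only [e1] at hs
  have e2 : (fun k => (∫ x, h x * ((ψ k).eval x * w x)) ^ 2 / N k) =
      fun i => inner ℝ (hL.toLp h) (b i) * inner ℝ (b i) (hL.toLp h) := ?_
  · rw [e2]; exact hs
  ext k
  have hc2 : inner ℝ (b k) (hL.toLp h) = inner ℝ (hL.toLp h) (b k) := real_inner_comm _ _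
  rw [hc2, ib]
  have := Real.sq_sqrt (hN k).le
  have h2 : √(N k) ≠ 0 := (Real.sqrt_pos.mpr (hN k)).ne'
  nth_rewrite 1 [← this]
  field_simp
end PartF2

section PartE
open scoped ENNReal

/-- The second-order Pearson operator. -/
def Lop (μ δ β γ : ℝ) (p : Polynomial ℝ) : Polynomial ℝ :=
  p.derivative.derivative * Qp δ β γ + p.derivative * ellp μ δ β 0

lemma Lop_sub (μ δ β γ : ℝ) (p r : Polynomial ℝ) :
    Lop μ δ β γ (p - r) = Lop μ δ β γ p - Lop μ δ β γ r := by
  simp only [Lop, Polynomial.derivative_sub]; ring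

lemma Lop_add (μ δ β γ : ℝ) (p r : Polynomial ℝ) :
    Lop μ δ β γ (p + r) = Lop μ δ β γ p + Lop μ δ β γ r := by
  simp only [Lop, Polynomial.derivative_add]; ring

lemma Lop_C (μ δ β γ c : ℝ) (p : Polynomial ℝ) :
    Lop μ δ β γ (Polynomial.C c * p) = Polynomial.C c * Lop μ δ β γ p := by
  simp only [Lop, Polynomial.derivative_C_mul]; ring

lemma Lop_X (μ δ β γ : ℝ) (j : ℕ) :
    (Lop μ δ β γ (Polynomial.X ^ j) + Polynomial.C (lam δ j) * Polynomial.X ^ j).degree < (j : WithBot ℕ) := by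
  rcases j with _ | _ | j
  · simp [Lop, lam]
  · have : Lop μ δ β γ (Polynomial.X ^ (0+1)) + Polynomial.C (lam δ (0+1)) * Polynomial.X ^ (0+1)
      = Polynomial.C μ := by simp [Lop, lam, ellp]
    rw [this]
    exact lt_of_le_of_lt Polynomial.degree_C_le (by simp)
  · have : Lop μ δ β γ (Polynomial.X ^ (j+1+1)) +
        Polynomial.C (lam δ (j+1+1)) * Polynomial.X ^ (j+1+1)
      = Polynomial.C ((j+2)*(j+1)*β + (j+2)*μ) * Polynomial.X ^ (j+1)
        + Polynomial.C ((j+2)*(j+1)*γ) * Polynomial.X ^ j := by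
      simp [Lop, lam, ellp, Qp]
      rw [show (Polynomial.C (2:ℝ)) = 2 from rfl]; ring
    rw [this]
    refine lt_of_le_of_lt (Polynomial.degree_add_le _ _) (max_lt ?_ ?_)
    · refine lt_of_le_of_lt (Polynomial.degree_C_mul_X_pow_le _ _) ?_
      exact_mod_cast Nat.lt_succ_self _
    · refine lt_of_le_of_lt (Polynomial.degree_C_mul_X_pow_le _ _) ?_
      exact_mod_cast (by omega : j < j+1+1)

lemma Lop_solve {δ : ℝ} (hδ : δ ≤ 0) (μ β γ : ℝ) (k j : ℕ) (hj : j ≤ k) :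
    ∀ t : Polynomial ℝ, t.degree < j → ∃ r : Polynomial ℝ, r.degree < j ∧
      Lop μ δ β γ r + Polynomial.C (lam δ k) * r = t := by
  induction j with
  | zero =>
    intro t ht
    refine ⟨0, by simp, ?_⟩
    have : t = 0 := by
      rw [← Polynomial.degree_eq_bot]
      simpa using ht
    rw [this]; simp [Lop]
  | succ j ih =>
    intro t ht
    have hne : lam δ k - lam δ j ≠ 0 := by
      intro h
      have := lam_inj hδ (sub_eq_zero.mp h)
      omega
    set c := t.coeff j / (lam δ k - lam δ j) with hc
    have hc2 : c * (lam δ k - lam δ j) = t.coeff j := by rw [hc]; field_simp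
    have h1 : (t - Polynomial.C (t.coeff j) * Polynomial.X ^ j).degree < (j : WithBot ℕ) := by
      rw [Polynomial.degree_lt_iff_coeff_zero] at ht ⊢
      intro m hm
      rcases hm.eq_or_lt with h | h
      · subst h; simp
      · rw [Polynomial.coeff_sub, ht m h, Polynomial.coeff_C_mul, Polynomial.coeff_X_pow,
          if_neg (by omega)]; simp
    obtain ⟨r, hr, hre⟩ := ih (by omega) ((t - Polynomial.C (t.coeff j) * Polynomial.X ^ j) -
      Polynomial.C c * (Lop μ δ β γ (Polynomial.X ^ j) +
        Polynomial.C (lam δ j) * Polynomial.X ^ j)) (by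
        refine lt_of_le_of_lt (Polynomial.degree_sub_le _ _) (max_lt h1 ?_)
        refine lt_of_le_of_lt ?_ (Lop_X μ δ β γ j)
        rw [← Polynomial.smul_eq_C_mul]
        exact Polynomial.degree_smul_le _ _)
    refine ⟨r + Polynomial.C c * Polynomial.X ^ j, ?_, ?_⟩
    · refine lt_of_le_of_lt (Polynomial.degree_add_le _ _) (max_lt ?_ ?_)
      · refine hr.trans ?_
        exact_mod_cast Nat.lt_succ_self _
      · refine lt_of_le_of_lt (Polynomial.degree_C_mul_X_pow_le _ _) ?_
        exact_mod_cast Nat.lt_succ_self _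
    · rw [Lop_add, Lop_C]
      have : Lop μ δ β γ r = t - Polynomial.C (t.coeff j) * Polynomial.X ^ j -
      Polynomial.C c * (Lop μ δ β γ (Polynomial.X ^ j) +
        Polynomial.C (lam δ j) * Polynomial.X ^ j) - Polynomial.C (lam δ k) * r := by
        rw [← hre]; ring
      rw [this, ← hc2]
      simp only [Polynomial.C_mul, Polynomial.C_sub]
      ring

lemma eig_exists {δ : ℝ} (hδ : δ ≤ 0) (μ β γ : ℝ) (k : ℕ) : ∃ p : Polynomial ℝ,
    p.Monic ∧ p.natDegree = k ∧ Lop μ δ β γ p = - (Polynomial.C (lam δ k) * p) := by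
  obtain ⟨r, hr, hre⟩ := Lop_solve hδ μ β γ k k le_rfl _ (Lop_X μ δ β γ k)
  refine ⟨Polynomial.X ^ k - r, ?_, ?_, ?_⟩
  · exact Polynomial.monic_X_pow_sub hr
  · apply Polynomial.natDegree_eq_of_degree_eq_some
    rw [Polynomial.degree_sub_eq_left_of_degree_lt (by simpa using hr), Polynomial.degree_X_pow]
  · rw [Lop_sub]
    have : Lop μ δ β γ r = Lop μ δ β γ (Polynomial.X ^ k) +
      Polynomial.C (lam δ k) * Polynomial.X ^ k - Polynomial.C (lam δ k) * r := by
      rw [← hre]; ring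
    rw [this]; ring

def eig (μ δ β γ : ℝ) (k : ℕ) : Polynomial ℝ := by
  classical exact if h : δ ≤ 0 then (eig_exists h μ β γ k).choose else 0

lemma eig_spec {δ : ℝ} (hδ : δ ≤ 0) (μ β γ : ℝ) (k : ℕ) : (eig μ δ β γ k).Monic ∧
    (eig μ δ β γ k).natDegree = k ∧
    Lop μ δ β γ (eig μ δ β γ k) = - (Polynomial.C (lam δ k) * eig μ δ β γ k) := by
  unfold eig
  rw [dif_pos hδ]
  exact (eig_exists hδ μ β γ k).choose_spec

lemma eig_deriv {δ : ℝ} (hδ : δ ≤ 0) (μ β γ : ℝ) (k i : ℕ) :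
    (Polynomial.derivative^[i+2] (eig μ δ β γ k)) * Qp δ β γ
      + Polynomial.derivative^[i+1] (eig μ δ β γ k) * ellp μ δ β i =
    - (Polynomial.C (lam δ k - lam δ i) * Polynomial.derivative^[i] (eig μ δ β γ k)) := by
  induction i with
  | zero =>
    have := (eig_spec hδ μ β γ k).2.2
    simpa [Lop, lam_zero] using this
  | succ i ih =>
    have h := congrArg Polynomial.derivative ih
    simp only [Polynomial.derivative_add, Polynomial.derivative_neg,
      Polynomial.derivative_mul, Polynomial.derivative_C, ← Function.iterate_succ_apply'] at h
    have hQ : (Qp δ β γ).derivative = Polynomial.C (2 * δ) * Polynomial.X + Polynomial.C β := by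
      simp [Qp]
      rw [show (Polynomial.C (2:ℝ)) = 2 from rfl]; ring
    have hl : (ellp μ δ β i).derivative = - Polynomial.C (1 - 2 * i * δ) := by
      simp [ellp]
    have hl2 : ellp μ δ β (i+1) = ellp μ δ β i + (Polynomial.C (2 * δ) * Polynomial.X + Polynomial.C β) := by
      simp [ellp]; ring
    have hlam : lam δ (i+1) = lam δ i + (1 - 2 * i * δ) := by
      simp [lam]; ring
    rw [hQ, hl] at h
    rw [hl2, hlam]
    simp only [Polynomial.C_sub, Polynomial.C_add] at h ⊢
    linear_combination h

namespace PF
variable {f : ℝ → ℝ} {J : Set ℝ} {μ δ β γ : ℝ}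

/-- Identity relating consecutive levels for functions. -/
lemma step_fun (H : PF f J μ δ β γ) (i k : ℕ) (h hd : ℝ → ℝ) (hF : FTC J h hd)
    (hc : ContinuousOn h J) (hdm : AEStronglyMeasurable hd (volume.restrict J))
    (hInt : Integrable fun x => hd x ^ 2 * wt f δ β γ (i+1) x) :
    ∫ x, hd x * ((Polynomial.derivative^[i+1] (eig μ δ β γ k)).eval x * wt f δ β γ (i+1) x) =
    (lam δ k - lam δ i) *
      ∫ x, h x * ((Polynomial.derivative^[i] (eig μ δ β γ k)).eval x * wt f δ β γ i x) := by
  obtain ⟨h1, h2⟩ := H.level i h hd hF hc hdm hInt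
  rw [h2 h1, ← Function.iterate_succ_apply' Polynomial.derivative, eig_deriv H.hδ,
    ← integral_neg, ← integral_const_mul]
  congr 1; ext x
  simp only [Polynomial.eval_neg, Polynomial.eval_mul, Polynomial.eval_C]
  ring

lemma step_poly (H : PF f J μ δ β γ) (i k : ℕ) (s : Polynomial ℝ) :
    ∫ x, s.derivative.eval x * ((Polynomial.derivative^[i+1] (eig μ δ β γ k)).eval x * wt f δ β γ (i+1) x) =
    (lam δ k - lam δ i) *
      ∫ x, s.eval x * ((Polynomial.derivative^[i] (eig μ δ β γ k)).eval x * wt f δ β γ i x) := by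
  have h0 := H.lev0 i (s * Polynomial.derivative^[i+1] (eig μ δ β γ k))
  have e := eig_deriv H.hδ μ β γ k i
  have e2 : (s * Polynomial.derivative^[i+1] (eig μ δ β γ k)).derivative * Qp δ β γ
      + s * Polynomial.derivative^[i+1] (eig μ δ β γ k) * ellp μ δ β i
      = s.derivative * Polynomial.derivative^[i+1] (eig μ δ β γ k) * Qp δ β γ
        - Polynomial.C (lam δ k - lam δ i) * (s * Polynomial.derivative^[i] (eig μ δ β γ k)) := by
    rw [Polynomial.derivative_mul, ← Function.iterate_succ_apply' Polynomial.derivative]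
    linear_combination s * e
  rw [e2] at h0
  rw [← integral_const_mul, ← sub_eq_zero]
  rw [← integral_sub]
  · rw [← h0]
    congr 1; ext x
    simp only [Polynomial.eval_sub, Polynomial.eval_mul, Polynomial.eval_C, Qp_eval, wt]
    ring
  · have := H.int_poly (i+1) (s.derivative * Polynomial.derivative^[i+1] (eig μ δ β γ k))
    simpa only [Polynomial.eval_mul, mul_assoc] using this
  · have := H.int_poly i (Polynomial.C (lam δ k - lam δ i) * (s * Polynomial.derivative^[i] (eig μ δ β γ k)))
    simpa only [Polynomial.eval_mul, Polynomial.eval_C, mul_assoc] using this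

lemma iter_poly (H : PF f J μ δ β γ) (i k : ℕ) (s : Polynomial ℝ) :
    ∫ x, (Polynomial.derivative^[i] s).eval x * ((Polynomial.derivative^[i] (eig μ δ β γ k)).eval x * wt f δ β γ i x) =
    piL δ i (lam δ k) *
      ∫ x, s.eval x * ((eig μ δ β γ k).eval x * wt f δ β γ 0 x) := by
  induction i with
  | zero => simp [piL]
  | succ i ih =>
    rw [Function.iterate_succ_apply' Polynomial.derivative i s, H.step_poly, ih, piL_succ]
    ring

def en (f : ℝ → ℝ) (μ δ β γ : ℝ) (k : ℕ) : ℝ :=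
  ∫ x, (eig μ δ β γ k).eval x * ((eig μ δ β γ k).eval x * wt f δ β γ 0 x)

lemma orth (H : PF f J μ δ β γ) (j k : ℕ) (hjk : j ≠ k) :
    ∫ x, (eig μ δ β γ j).eval x * ((eig μ δ β γ k).eval x * wt f δ β γ 0 x) = 0 := by
  have h1 := H.iter_poly 1 k (eig μ δ β γ j)
  have h2 := H.iter_poly 1 j (eig μ δ β γ k)
  have comm : ∀ (p r : Polynomial ℝ) (i : ℕ), ∫ x, p.eval x * (r.eval x * wt f δ β γ i x) =
      ∫ x, r.eval x * (p.eval x * wt f δ β γ i x) := by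
    intro p r i; congr 1; ext x; ring
  rw [comm, comm (eig μ δ β γ k)] at h2
  have h3 := h1.symm.trans h2
  have h4 : piL δ 1 (lam δ k) - piL δ 1 (lam δ j) ≠ 0 := by
    simp only [piL, Finset.prod_range_one]
    intro h
    exact hjk (lam_inj H.hδ (by linarith))
  rw [← sub_eq_zero, ← sub_mul] at h3
  exact (mul_eq_zero.mp h3).resolve_left h4

lemma sq_pos (H : PF f J μ δ β γ) (p : Polynomial ℝ) (hp : p ≠ 0) :
    0 < ∫ x, p.eval x * (p.eval x * wt f δ β γ 0 x) := by
  have hi : Integrable fun x => p.eval x * (p.eval x * wt f δ β γ 0 x) := by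
    have := H.int_poly 0 (p*p)
    simpa only [Polynomial.eval_mul, mul_assoc] using this
  have hnn : ∀ x, 0 ≤ p.eval x * (p.eval x * wt f δ β γ 0 x) := fun x => by
    rw [← mul_assoc]; exact mul_nonneg (mul_self_nonneg _) (H.wt_nn 0 x)
  rw [integral_pos_iff_support_of_nonneg hnn hi]
  have hs : J \ (p.roots.toFinset : Set ℝ) ⊆
      Function.support fun x => p.eval x * (p.eval x * wt f δ β γ 0 x) := by
    intro x hx
    have h1 : p.eval x ≠ 0 := by
      intro h
      apply hx.2
      simp [hp, h]
    exact mul_ne_zero h1 (mul_ne_zero h1 (H.wt_pos 0 hx.1).ne')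
  refine lt_of_lt_of_le ?_ (measure_mono hs)
  rw [measure_sdiff_null ((Finset.finite_toSet _).measure_zero _)]
  exact H.J_pos

lemma en_pos (H : PF f J μ δ β γ) (k : ℕ) : 0 < en f μ δ β γ k :=
  H.sq_pos _ (eig_spec H.hδ μ β γ k).1.ne_zero

end PF

lemma piL_pos {δ : ℝ} (hδ : δ ≤ 0) {i k : ℕ} (h : i ≤ k) : 0 < piL δ i (lam δ k) := by
  apply Finset.prod_pos
  intro j hj
  rw [sub_pos]
  exact lam_lt hδ (by have := Finset.mem_range.mp hj; omega)

lemma piL_zero {δ : ℝ} {i k : ℕ} (h : k < i) : piL δ i (lam δ k) = 0 := by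
  apply Finset.prod_eq_zero (Finset.mem_range.mpr h)
  simp

end PartE

section PartG
open scoped ENNReal

lemma eig_deg {δ : ℝ} (hδ : δ ≤ 0) (μ β γ : ℝ) (k i : ℕ) :
    (Polynomial.derivative^[i] (eig μ δ β γ (k+i))).degree = k := by
  obtain ⟨h1, h2, -⟩ := eig_spec hδ μ β γ (k+i)
  refine Polynomial.degree_eq_of_le_of_coeff_ne_zero ?_ ?_
  · refine Polynomial.natDegree_le_iff_degree_le.mp ?_
    refine (Polynomial.natDegree_iterate_derivative _ _).trans ?_
    rw [h2]; omega
  · rw [Polynomial.coeff_iterate_derivative]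
    have : (eig μ δ β γ (k+i)).coeff (k+i) = 1 := by
      have := h1.coeff_natDegree
      rwa [h2] at this
    rw [this]
    simp [Nat.descFactorial_eq_zero_iff_lt]

lemma eig_self {δ : ℝ} (hδ : δ ≤ 0) (μ β γ : ℝ) (i : ℕ) :
    Polynomial.derivative^[i] (eig μ δ β γ i) = Polynomial.C (i.factorial : ℝ) := by
  have h := eig_deg hδ μ β γ 0 i
  rw [zero_add] at h
  refine (Polynomial.eq_C_of_degree_le_zero (le_of_eq (by simpa using h))).trans ?_
  congr 1
  rw [Polynomial.coeff_iterate_derivative]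
  obtain ⟨h1, h2, -⟩ := eig_spec hδ μ β γ i
  have : (eig μ δ β γ i).coeff (0+i) = 1 := by
      have := h1.coeff_natDegree
      rw [h2] at this
      simpa using this
  rw [this]
  simp [Nat.descFactorial_self]

namespace PF
variable {f : ℝ → ℝ} {J : Set ℝ} {μ δ β γ : ℝ}

lemma wt_exp (H : PF f J μ δ β γ) (i : ℕ) :
    ∃ c > 0, Integrable fun x => Real.exp (c * |x|) * wt f δ β γ i x := by
  obtain ⟨c, hc, hi⟩ := H.expint
  refine ⟨c/2, by positivity, ?_⟩
  have := int_poly_exp H.fmeas c hc hi (Qp δ β γ ^ i)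
  refine this.congr (ae_of_all _ fun x => ?_)
  simp only [Polynomial.eval_pow, Qp_eval, wt]; ring

lemma pars (H : PF f J μ δ β γ) (i : ℕ) (h : ℝ → ℝ)
    (hm : AEStronglyMeasurable h (volume.restrict J))
    (hh : Integrable fun x => h x ^ 2 * wt f δ β γ i x) :
    HasSum (fun k => (∫ x, h x * ((Polynomial.derivative^[i] (eig μ δ β γ (k+i))).eval x
      * wt f δ β γ i x)) ^ 2 / (piL δ i (lam δ (k+i)) * en f μ δ β γ (k+i)))
      (∫ x, h x ^ 2 * wt f δ β γ i x) := by
  have hJm : MeasurableSet J := H.Jopen.measurableSet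
  obtain ⟨h0, h0m, h0e⟩ : ∃ h0 : ℝ → ℝ, Measurable h0 ∧ ∀ᵐ x : ℝ, x ∈ J → h x = h0 x :=
    ⟨hm.mk h, hm.stronglyMeasurable_mk.measurable,
      (ae_restrict_iff' hJm).mp hm.ae_eq_mk⟩
  have e1 : (fun x => h x ^ 2 * wt f δ β γ i x) =ᵐ[volume] fun x => h0 x ^ 2 * wt f δ β γ i x := by
    filter_upwards [h0e] with x hx
    by_cases hxJ : x ∈ J
    · rw [hx hxJ]
    · rw [H.wt_zero i hxJ]; simp
  have e2 : ∀ p : Polynomial ℝ, ∫ x, h x * (p.eval x * wt f δ β γ i x) =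
      ∫ x, h0 x * (p.eval x * wt f δ β γ i x) := by
    intro p
    apply integral_congr_ae
    filter_upwards [h0e] with x hx
    by_cases hxJ : x ∈ J
    · rw [hx hxJ]
    · rw [H.wt_zero i hxJ]; simp
  simp_rw [e2]
  rw [integral_congr_ae e1]
  obtain ⟨c, hc, he⟩ := H.wt_exp i
  refine parseval _ (H.wt_meas i) (H.wt_nn i) c hc he
    (fun k => Polynomial.derivative^[i] (eig μ δ β γ (k+i))) (fun k => eig_deg H.hδ μ β γ k i)
    ?_ (fun k => piL δ i (lam δ (k+i)) * en f μ δ β γ (k+i)) ?_ ?_ h0 h0m (hh.congr e1)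
  · intro j k hjk
    rw [H.iter_poly, H.orth _ _ (by omega), mul_zero]
  · intro k
    exact mul_pos (piL_pos H.hδ (by omega)) (H.en_pos _)
  · intro k
    rw [H.iter_poly]; rfl

lemma sq_int (H : PF f J μ δ β γ) (n : ℕ) (gd : ℕ → ℝ → ℝ)
    (hF : ∀ i < n, FTC J (gd i) (gd (i+1))) (hc : ∀ i < n, ContinuousOn (gd i) J)
    (hm : ∀ i ≤ n, AEStronglyMeasurable (gd i) (volume.restrict J))
    (hi : Integrable fun x => gd n x ^ 2 * wt f δ β γ n x) (i : ℕ) (hin : i ≤ n) :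
    Integrable fun x => gd i x ^ 2 * wt f δ β γ i x := by
  induction hin using Nat.decreasingInduction with
  | self => exact hi
  | of_succ k hk ih =>
    exact (H.level k (gd k) (gd (k+1)) (hF k hk) (hc k hk) (hm (k+1) hk) ih).1

/-- Fourier coefficient. -/
def fc (f : ℝ → ℝ) (μ δ β γ : ℝ) (g : ℝ → ℝ) (k : ℕ) : ℝ :=
  ∫ x, g x * ((eig μ δ β γ k).eval x * wt f δ β γ 0 x)

lemma fc_iter (H : PF f J μ δ β γ) (n : ℕ) (gd : ℕ → ℝ → ℝ)
    (hF : ∀ i < n, FTC J (gd i) (gd (i+1))) (hc : ∀ i < n, ContinuousOn (gd i) J)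
    (hm : ∀ i ≤ n, AEStronglyMeasurable (gd i) (volume.restrict J))
    (hi : Integrable fun x => gd n x ^ 2 * wt f δ β γ n x) (k i : ℕ) (hin : i ≤ n) :
    ∫ x, gd i x * ((Polynomial.derivative^[i] (eig μ δ β γ k)).eval x * wt f δ β γ i x)
      = piL δ i (lam δ k) * fc f μ δ β γ (gd 0) k := by
  induction i with
  | zero => simp [piL, fc]
  | succ i ih =>
    rw [H.step_fun i k (gd i) (gd (i+1)) (hF i hin) (hc i hin) (hm (i+1) hin)
      (H.sq_int n gd hF hc hm hi (i+1) hin), ih (by omega), piL_succ]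
    ring

/-- Energy in the k-th mode. -/
def ck (f : ℝ → ℝ) (μ δ β γ : ℝ) (g : ℝ → ℝ) (k : ℕ) : ℝ :=
  fc f μ δ β γ g k ^ 2 / en f μ δ β γ k

lemma pars_gd (H : PF f J μ δ β γ) (n : ℕ) (gd : ℕ → ℝ → ℝ)
    (hF : ∀ i < n, FTC J (gd i) (gd (i+1))) (hc : ∀ i < n, ContinuousOn (gd i) J)
    (hm : ∀ i ≤ n, AEStronglyMeasurable (gd i) (volume.restrict J))
    (hi : Integrable fun x => gd n x ^ 2 * wt f δ β γ n x) (i : ℕ) (hin : i ≤ n) :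
    HasSum (fun k => piL δ i (lam δ k) * ck f μ δ β γ (gd 0) k)
      (∫ x, gd i x ^ 2 * wt f δ β γ i x) := by
  have h := H.pars i (gd i) (hm i hin) (H.sq_int n gd hF hc hm hi i hin)
  simp_rw [H.fc_iter n gd hF hc hm hi _ i hin] at h
  rw [← hasSum_nat_add_iff' i]
  rw [Finset.sum_eq_zero (fun k hk => by
    rw [piL_zero (Finset.mem_range.mp hk), zero_mul]), sub_zero]
  have e : ∀ k, piL δ i (lam δ (k+i)) * ck f μ δ β γ (gd 0) (k+i) =
      (piL δ i (lam δ (k+i)) * fc f μ δ β γ (gd 0) (k+i)) ^ 2 /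
        (piL δ i (lam δ (k+i)) * en f μ δ β γ (k+i)) := ?_
  · simp_rw [e]; exact h
  intro k
  have h1 := piL_pos H.hδ (show i ≤ k + i by omega)
  have h2 := H.en_pos (k+i)
  rw [ck]
  field_simp

/-- The linear functional terms. -/
lemma lin_term (H : PF f J μ δ β γ) (n : ℕ) (gd : ℕ → ℝ → ℝ)
    (hF : ∀ i < n, FTC J (gd i) (gd (i+1))) (hc : ∀ i < n, ContinuousOn (gd i) J)
    (hm : ∀ i ≤ n, AEStronglyMeasurable (gd i) (volume.restrict J))
    (hi : Integrable fun x => gd n x ^ 2 * wt f δ β γ n x) (i : ℕ) (hin : i ≤ n) :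
    0 < ∫ x, wt f δ β γ i x ∧
    (∫ x, gd i x * wt f δ β γ i x) ^ 2 =
      piL δ i (lam δ i) * ck f μ δ β γ (gd 0) i * ∫ x, wt f δ β γ i x := by
  have h1 := H.fc_iter n gd hF hc hm hi i i hin
  have h2 := H.iter_poly i i (eig μ δ β γ i)
  rw [eig_self H.hδ] at h1 h2
  simp only [Polynomial.eval_C, mul_left_comm _ (i.factorial : ℝ), integral_const_mul] at h1 h2
  have hf : (0:ℝ) < i.factorial := by positivity
  have h3 := piL_pos H.hδ (le_refl i)
  have h4 := H.en_pos i
  rw [show ∫ x, (eig μ δ β γ i).eval x * ((eig μ δ β γ i).eval x * wt f δ β γ 0 x)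
    = en f μ δ β γ i from rfl] at h2
  have h5 : 0 < ∫ x, wt f δ β γ i x := by
    have : 0 < (i.factorial:ℝ) * (i.factorial * ∫ x, wt f δ β γ i x) := by
      rw [h2]; positivity
    rw [← mul_assoc] at this
    exact (pos_iff_pos_of_mul_pos this).mp (by positivity)
  refine ⟨h5, ?_⟩
  rw [ck]
  have h6 : ∫ x, wt f δ β γ i x = piL δ i (lam δ i) * en f μ δ β γ i / i.factorial ^ 2 := by
    rw [← h2]; field_simp
  have h7 : ∫ x, gd i x * wt f δ β γ i x =
      piL δ i (lam δ i) * fc f μ δ β γ (gd 0) i / i.factorial := by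
    rw [← h1]; field_simp
  rw [h6, h7]
  field_simp

end PF
end PartG

section PartI
open scoped ENNReal

lemma final_arith {δ : ℝ} (hδ : δ ≤ 0) {n : ℕ} (hn : 1 ≤ n) (c : ℕ → ℝ) (hc : ∀ k, 0 ≤ c k)
    (A B : ℝ)
    (hA : HasSum (fun k => Tp δ 0 n (lam δ (k+(n+1))) * c (k+(n+1))) A)
    (hB : HasSum (fun k => Tp δ n n (lam δ (k+(n+1))) * c (k+(n+1))) B) :
    ((2 * n).choose n : ℝ) * (pp δ (n : ℝ) n / pp δ 0 n) * |B| ≤ |A| ∧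
    (|A| = ((2 * n).choose n : ℝ) * (pp δ (n : ℝ) n / pp δ 0 n) * |B| ↔ ∀ k, n < k → c k = 0) := by
  set K := ((2 * n).choose n : ℝ) * (pp δ (n : ℝ) n / pp δ 0 n) with hK
  have hKp : 0 ≤ K := by
    have h1 := pp_pos hδ (show (0:ℝ) ≤ n by positivity) n
    have h2 := pp_pos hδ (le_refl (0:ℝ)) n
    positivity
  have key := fun k => key_ineq hδ hn (show n < k + (n+1) by omega)
  have hA1 := hA.mul_left ((-1:ℝ)^n)
  have hB1 := hB.mul_left ((-1:ℝ)^n)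
  have hBn : 0 ≤ (-1:ℝ)^n * B := hB1.nonneg fun k => by
    rw [← mul_assoc]; exact mul_nonneg (key k).1 (hc _)
  have hAn : 0 ≤ (-1:ℝ)^n * A := hA1.nonneg fun k => by
    rw [← mul_assoc]
    exact mul_nonneg ((mul_nonneg hKp (key k).1).trans (key k).2.le) (hc _)
  have ab : ∀ x : ℝ, 0 ≤ (-1:ℝ)^n * x → |x| = (-1:ℝ)^n * x := fun x hx => by
    have := abs_of_nonneg hx
    rwa [abs_mul, abs_pow, abs_neg, abs_one, one_pow, one_mul] at this
  rw [ab A hAn, ab B hBn]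
  have hD := hA1.sub (hB1.mul_left K)
  have hterm : ∀ k, 0 ≤ (-1:ℝ)^n * (Tp δ 0 n (lam δ (k+(n+1))) * c (k+(n+1))) -
      K * ((-1:ℝ)^n * (Tp δ n n (lam δ (k+(n+1))) * c (k+(n+1)))) := by
    intro k
    have := mul_nonneg (sub_nonneg.mpr (key k).2.le) (hc (k+(n+1)))
    rw [← hK] at this
    linarith
  have hnn := hD.nonneg hterm
  refine ⟨by linarith, ?_, ?_⟩
  · intro h k hk
    rw [show (-1:ℝ)^n * A - K * ((-1:ℝ)^n * B) = 0 by linarith] at hD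
    have h0 := (hasSum_zero_iff_of_nonneg hterm).mp hD
    have h1 := congrFun h0 (k - (n+1))
    simp only [Nat.sub_add_cancel (show n+1 ≤ k from hk), Pi.zero_apply] at h1
    have h2 := (key_ineq hδ hn hk).2
    rw [← hK] at h2
    have h3 : ((-1:ℝ)^n * Tp δ 0 n (lam δ k) - K * ((-1:ℝ)^n * Tp δ n n (lam δ k))) * c k = 0 := by
      linarith
    exact (mul_eq_zero.mp h3).resolve_left (sub_pos.mpr h2).ne'
  · intro h
    have e : ∀ k, c (k+(n+1)) = 0 := fun k => h _ (by omega)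
    simp only [e, mul_zero] at hA hB
    rw [hA.unique hasSum_zero, hB.unique hasSum_zero]; simp

/-- Regularity data extracted from `MemH`. -/
lemma memH_data {P : Measure ℝ} {q : ℝ → ℝ} {J : Set ℝ} (Jo : IsOpen J) (Jc : J.OrdConnected)
    {n : ℕ} (hn : 1 ≤ n) {gd : ℕ → ℝ → ℝ} (hg : MemH P q J n n gd) :
    (∀ i < n, FTC J (gd i) (gd (i+1))) ∧ (∀ i < n, ContinuousOn (gd i) J) ∧
    (∀ i ≤ n, AEStronglyMeasurable (gd i) (volume.restrict J)) := by
  obtain ⟨h1, h2, h3, -, -⟩ := hg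
  rw [max_self] at h1 h2 h3
  have hcont : ∀ i < n, ContinuousOn (gd i) J := by
    intro i hi
    by_cases hi2 : i + 1 < n
    · exact fun x hx => (h1 i hi2 x hx).continuousAt.continuousWithinAt
    · have : i = n - 1 := by omega
      rw [this]; exact h2 hn
  have hF : ∀ i < n, FTC J (gd i) (gd (i+1)) := by
    intro i hi
    by_cases hi2 : i + 1 < n
    · intro a ha b hb
      have hsub : Set.uIcc a b ⊆ J := Jc.uIcc_subset ha hb
      have hii : IntervalIntegrable (gd (i+1)) volume a b :=
        ((hcont (i+1) hi2).mono hsub).intervalIntegrable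
      exact ⟨hii, (intervalIntegral.integral_eq_sub_of_hasDerivAt
        (fun x hx => h1 i hi2 x (hsub hx)) hii).symm⟩
    · intro a ha b hb
      have h := h3 hn a ha b hb
      rw [show n - 1 = i by omega] at h
      rw [show i + 1 = n by omega]
      exact h
  refine ⟨hF, hcont, ?_⟩
  intro i hi
  rcases hi.lt_or_eq with hi | rfl
  · exact (hcont i hi).aestronglyMeasurable Jo.measurableSet
  · have : LocallyIntegrableOn (gd i) J volume := by
      intro x hx
      obtain ⟨l, u, hxlu, hlu⟩ := mem_nhds_iff_exists_Ioo_subset.mp (Jo.mem_nhds hx)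
      obtain ⟨a, ha1, ha2⟩ := exists_between hxlu.1
      obtain ⟨b, hb1, hb2⟩ := exists_between hxlu.2
      have haJ : a ∈ J := hlu ⟨ha1, by linarith⟩
      have hbJ : b ∈ J := hlu ⟨by linarith, hb2⟩
      have hI := (h3 hn a haJ b hbJ).1
      rw [intervalIntegrable_iff_integrableOn_Ioo_of_le (by linarith)] at hI
      exact ⟨Set.Ioo a b, mem_nhdsWithin_of_mem_nhds (Ioo_mem_nhds ha2 hb1), hI⟩
    exact this.aestronglyMeasurable

namespace PF
variable {f : ℝ → ℝ} {J : Set ℝ} {μ δ β γ : ℝ}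

lemma mul_int (H : PF f J μ δ β γ) (g : ℝ → ℝ) (hm : AEStronglyMeasurable g (volume.restrict J))
    (hi : Integrable fun x => g x ^ 2 * wt f δ β γ 0 x) (p : Polynomial ℝ) :
    Integrable fun x => g x * (p.eval x * wt f δ β γ 0 x) := by
  have h2 := H.int_poly 0 (p^2)
  refine Integrable.mono (hi.add h2) ?_ (ae_of_all _ fun x => ?_)
  · have hJm : MeasurableSet J := H.Jopen.measurableSet
    refine AEStronglyMeasurable.congr (f := fun x => (J.indicator g x) * (p.eval x * wt f δ β γ 0 x)) ?_ (ae_of_all _ fun x => ?_)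
    · exact ((aestronglyMeasurable_indicator_iff hJm).mpr hm).mul
        (p.continuous.measurable.mul (H.wt_meas 0)).aestronglyMeasurable
    · by_cases hx : x ∈ J
      · simp [hx]
      · simp [H.wt_zero 0 hx]
  · have hw := H.wt_nn 0 x
    simp only [Pi.add_apply, Polynomial.eval_pow]
    rw [← add_mul, ← mul_assoc, Real.norm_eq_abs, Real.norm_eq_abs, abs_mul, abs_mul (_ + _),
      abs_of_nonneg hw, abs_of_nonneg (add_nonneg (sq_nonneg (g x)) (sq_nonneg (p.eval x)))]
    gcongr
    rw [abs_le]
    constructor <;> nlinarith [sq_nonneg (g x + p.eval x), sq_nonneg (g x - p.eval x)]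

lemma ck_nn (H : PF f J μ δ β γ) (g : ℝ → ℝ) (k : ℕ) : 0 ≤ ck f μ δ β γ g k :=
  div_nonneg (sq_nonneg _) (H.en_pos k).le

lemma poly_iff (H : PF f J μ δ β γ) (g : ℝ → ℝ) (hc : ContinuousOn g J)
    (hi : Integrable fun x => g x ^ 2 * wt f δ β γ 0 x) (n : ℕ) :
    (∀ k, n < k → ck f μ δ β γ g k = 0) ↔ IsPolyOn g J n := by
  have hJm : MeasurableSet J := H.Jopen.measurableSet
  have hm : AEStronglyMeasurable g (volume.restrict J) := hc.aestronglyMeasurable hJm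
  constructor
  · intro h
    have hfc : ∀ k, n < k → fc f μ δ β γ g k = 0 := by
      intro k hk
      have := h k hk
      rw [ck, div_eq_zero_iff] at this
      exact pow_eq_zero_iff two_ne_zero |>.mp (this.resolve_right (H.en_pos k).ne')
    set p : Polynomial ℝ := ∑ k ∈ Finset.range (n+1),
      Polynomial.C (fc f μ δ β γ g k / en f μ δ β γ k) * eig μ δ β γ k with hp
    refine ⟨p, ?_, ?_⟩
    · refine Polynomial.natDegree_sum_le_of_forall_le _ _ fun k hk => ?_
      refine (Polynomial.natDegree_C_mul_le _ _).trans ?_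
      rw [(eig_spec H.hδ μ β γ k).2.1]
      have := Finset.mem_range.mp hk; omega
    · have hpi : ∀ k, Integrable fun x => p.eval x * ((eig μ δ β γ k).eval x * wt f δ β γ 0 x) := by
        intro k
        have := H.int_poly 0 (p * eig μ δ β γ k)
        simpa only [Polynomial.eval_mul, mul_assoc] using this
      have hpk : ∀ k, ∫ x, p.eval x * ((eig μ δ β γ k).eval x * wt f δ β γ 0 x) =
          fc f μ δ β γ g k := by
        intro k
        have e : ∀ x, p.eval x * ((eig μ δ β γ k).eval x * wt f δ β γ 0 x) =
          ∑ j ∈ Finset.range (n+1), fc f μ δ β γ g j / en f μ δ β γ j *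
            ((eig μ δ β γ j).eval x * ((eig μ δ β γ k).eval x * wt f δ β γ 0 x)) := by
          intro x
          rw [hp, Polynomial.eval_finsetSum, Finset.sum_mul]
          simp only [Polynomial.eval_mul, Polynomial.eval_C, mul_assoc]
        simp_rw [e]
        rw [integral_finsetSum]
        · simp_rw [integral_const_mul]
          by_cases hk : k ∈ Finset.range (n+1)
          · rw [Finset.sum_eq_single_of_mem k hk]
            · rw [show ∫ x, (eig μ δ β γ k).eval x * ((eig μ δ β γ k).eval x * wt f δ β γ 0 x)
                = en f μ δ β γ k from rfl]
              have := H.en_pos k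
              field_simp
            · intro j _ hjk
              rw [H.orth j k hjk, mul_zero]
          · rw [hfc k (by simpa using hk)]
            refine Finset.sum_eq_zero fun j hj => ?_
            rw [H.orth j k (by rintro rfl; exact hk hj), mul_zero]
        · intro j _
          refine Integrable.const_mul ?_ _
          have := H.int_poly 0 (eig μ δ β γ j * eig μ δ β γ k)
          simpa only [Polynomial.eval_mul, mul_assoc] using this
      have hsq : Integrable fun x => (g x - p.eval x) ^ 2 * wt f δ β γ 0 x := by
        have i1 := (H.mul_int g hm hi p).const_mul 2
        have i2 := H.int_poly 0 (p^2)
        refine ((hi.sub i1).add i2).congr (ae_of_all _ fun x => ?_)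
        simp only [Pi.add_apply, Pi.sub_apply, Polynomial.eval_pow]; ring
      have hpars := H.pars 0 (fun x => g x - p.eval x)
        (hm.sub p.continuous.measurable.aestronglyMeasurable) hsq
      have hz : ∀ k, ∫ x, (g x - p.eval x) * ((Polynomial.derivative^[0] (eig μ δ β γ (k+0))).eval x
          * wt f δ β γ 0 x) = 0 := by
        intro k
        simp only [Function.iterate_zero, id, add_zero, sub_mul]
        rw [integral_sub (H.mul_int g hm hi _) (hpi k), hpk k]
        exact sub_self _
      simp only [hz] at hpars
      have h0 : ∫ x, (g x - p.eval x) ^ 2 * wt f δ β γ 0 x = 0 := by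
        refine hpars.unique ?_
        simp only [ne_eq, OfNat.ofNat_ne_zero, not_false_eq_true, zero_pow, zero_div]
        exact hasSum_zero
      rw [integral_eq_zero_iff_of_nonneg
        (fun x => mul_nonneg (sq_nonneg _) (H.wt_nn 0 x)) hsq] at h0
      have hae : g =ᵐ[volume.restrict J] fun x => p.eval x := by
        rw [Filter.EventuallyEq, ae_restrict_iff' hJm]
        filter_upwards [h0] with x hx hxJ
        have := (mul_eq_zero.mp hx).resolve_right (H.wt_pos 0 hxJ).ne'
        exact sub_eq_zero.mp (pow_eq_zero_iff two_ne_zero |>.mp this)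
      exact Measure.eqOn_open_of_ae_eq hae H.Jopen hc p.continuous.continuousOn
  · rintro ⟨p, hp, hgp⟩ k hk
    have e : fc f μ δ β γ g k = ∫ x, p.eval x * ((eig μ δ β γ k).eval x * wt f δ β γ 0 x) := by
      rw [fc]; congr 1; ext x
      by_cases hx : x ∈ J
      · rw [hgp x hx]
      · rw [H.wt_zero 0 hx]; simp
    have h1 := H.iter_poly (n+1) k p
    rw [Polynomial.iterate_derivative_eq_zero (by omega), ← e] at h1
    simp only [Polynomial.eval_zero, zero_mul, integral_zero] at h1
    have h2 := piL_pos H.hδ (show n+1 ≤ k from hk)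
    have : fc f μ δ β γ g k = 0 := (mul_eq_zero.mp h1.symm).resolve_left h2.ne'
    rw [ck, this]; simp

end PF
end PartI

/-- **Corollary 3.1.** If `X ∼ IP(μ; δ, β, γ)` with `δ ≤ 0`, `n ≥ 1` and
`g ∈ H^{n,n}(X)`, then
`|Var g(X) − S_{0,n}(g)| ≥ C(2n,n) (∏_{j=n}^{2n−1}(1−jδ)/∏_{j=0}^{n−1}(1−jδ)) |Var g(X) − S_{n,n}(g)|`,
with equality iff `g` coincides on the support of `X` with a polynomial of degree
at most `n`. -/
theorem pearson_Snn_better_than_Sn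
    (P : Measure ℝ) (f : ℝ → ℝ) (μ δ β γ : ℝ) (hδ : δ ≤ 0)
    (hIP : IsIntegratedPearson P f μ δ β γ)
    (α ω : EReal) (hsupp : {x : ℝ | 0 < f x} = erealIoo α ω)
    (n : ℕ) (hn : 1 ≤ n) (gd : ℕ → ℝ → ℝ)
    (hg : MemH P (pq δ β γ) (erealIoo α ω) n n gd) :
    ((2 * n).choose n : ℝ) * (pp δ (n : ℝ) n / pp δ 0 n) *
        |variance (gd 0) P - Sbound P δ (pq δ β γ) n n gd| ≤
      |variance (gd 0) P - Sbound P δ (pq δ β γ) 0 n gd| ∧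
    (|variance (gd 0) P - Sbound P δ (pq δ β γ) 0 n gd| =
        ((2 * n).choose n : ℝ) * (pp δ (n : ℝ) n / pp δ 0 n) *
          |variance (gd 0) P - Sbound P δ (pq δ β γ) n n gd| ↔
      IsPolyOn (gd 0) (erealIoo α ω) n) := by
  have H : PF f (erealIoo α ω) μ δ β γ := pf_of_IP P f μ δ β γ hδ hIP α ω hsupp
  obtain ⟨hF, hc, hm⟩ := memH_data H.Jopen H.Jord hn hg
  obtain ⟨hPp, hfnn, hP, -, -, -, -⟩ := hIP
  have I1 : ∀ g : ℝ → ℝ, ∫ x, g x ∂P = ∫ x, g x * f x := by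
    intro g
    rw [hP, integral_withDensity_eq_integral_toReal_smul H.fmeas.ennreal_ofReal (by simp)]
    congr 1; ext x
    rw [ENNReal.toReal_ofReal (hfnn x), smul_eq_mul, mul_comm]
  have I2 : ∀ g : ℝ → ℝ, Integrable g P ↔ Integrable fun x => g x * f x := by
    intro g
    rw [hP, integrable_withDensity_iff H.fmeas.ennreal_ofReal (by simp)]
    simp only [ENNReal.toReal_ofReal (hfnn _)]
  have hi : Integrable fun x => gd n x ^ 2 * wt f δ β γ n x := by
    have := (I2 _).mp hg.2.2.2.1
    refine this.congr (ae_of_all _ fun x => ?_)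
    simp only [wt]; ring
  have hsq := H.sq_int n gd hF hc hm hi
  have Qi : ∀ i, ∫ x, pq δ β γ x ^ i * (gd i x) ^ 2 ∂P = ∫ x, gd i x ^ 2 * wt f δ β γ i x := by
    intro i; rw [I1]; congr 1; ext x; simp only [wt]; ring
  have Li : ∀ i, ∫ x, pq δ β γ x ^ i * gd i x ∂P = ∫ x, gd i x * wt f δ β γ i x := by
    intro i; rw [I1]; congr 1; ext x; simp only [wt]; ring
  have Wi : ∀ i, ∫ x, pq δ β γ x ^ i ∂P = ∫ x, wt f δ β γ i x := by
    intro i; rw [I1]; simp only [wt]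
  set c := PF.ck f μ δ β γ (gd 0) with hcdef
  set Q : ℕ → ℝ := fun i => ∫ x, gd i x ^ 2 * wt f δ β γ i x with hQ
  have lin := H.lin_term n gd hF hc hm hi
  have w0 : ∫ x, wt f δ β γ 0 x = 1 := by
    rw [← Wi]; simp
  have hvar : variance (gd 0) P = Q 0 - c 0 := by
    have ham : AEStronglyMeasurable (gd 0) P := by
      have h0 := hm 0 (by omega)
      refine ⟨h0.mk, h0.stronglyMeasurable_mk, ?_⟩
      rw [Filter.EventuallyEq, hP, ae_withDensity_iff H.fmeas.ennreal_ofReal]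
      filter_upwards [(ae_restrict_iff' H.Jopen.measurableSet).mp h0.ae_eq_mk] with x hx hne
      apply hx
      by_contra hxJ
      rw [H.fzero x hxJ] at hne
      simp at hne
    have hL : MemLp (gd 0) 2 P := by
      rw [memLp_two_iff_integrable_sq ham, I2]
      refine (hsq 0 (by omega)).congr (ae_of_all _ fun x => ?_)
      simp [wt]
    rw [variance_eq_sub hL]
    have h1 := Qi 0
    have h2 := Li 0
    have h3 := (lin 0 (by omega)).2
    simp only [pow_zero, one_mul] at h1 h2
    rw [w0, ← h2] at h3
    simp only [Pi.pow_apply]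
    rw [h1, h3]
    simp [piL, hQ, hcdef]
  have sumT : ∀ m, HasSum (fun k => Tp δ m n (lam δ k) * c k)
      (∑ i ∈ Finset.range (n+1), (-1:ℝ)^i * Bc δ m n i * Q i) := by
    intro m
    have : ∀ k, Tp δ m n (lam δ k) * c k = ∑ i ∈ Finset.range (n+1),
        (-1:ℝ)^i * Bc δ m n i * (piL δ i (lam δ k) * c k) := by
      intro k
      rw [← T_expand hδ, Finset.sum_mul]
      exact Finset.sum_congr rfl fun i _ => by ring
    simp_rw [this]
    refine hasSum_sum fun i hi' => ?_
    exact (H.pars_gd n gd hF hc hm hi i (by have := Finset.mem_range.mp hi'; omega)).mul_left _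
  have tail : ∀ m, HasSum (fun k => Tp δ m n (lam δ (k+(n+1))) * c (k+(n+1)))
      ((∑ i ∈ Finset.range (n+1), (-1:ℝ)^i * Bc δ m n i * Q i)
        - ∑ k ∈ Finset.range (n+1), Tp δ m n (lam δ k) * c k) := fun m =>
    (hasSum_nat_add_iff' (n+1)).mpr (sumT m)
  have split : ∀ F : ℕ → ℝ, ∑ i ∈ Finset.range (n+1), F i = F 0 + ∑ i ∈ Finset.Icc 1 n, F i := by
    intro F
    rw [Finset.range_eq_Ico, Finset.sum_eq_sum_Ico_succ_bot (by omega)]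
    rfl
  have Bsum : ∀ m, ∑ i ∈ Finset.range (n+1), (-1:ℝ)^i * Bc δ m n i * Q i =
      Q 0 - ∑ i ∈ Finset.Icc 1 n, (-1 : ℝ) ^ (i - 1) *
          ((n.choose i : ℝ) / (fall ((m : ℝ) + n) i * pp δ (m : ℝ) i)) *
        ∫ x, pq δ β γ x ^ i * (gd i x) ^ 2 ∂P := by
    intro m
    rw [split, sub_eq_add_neg, ← Finset.sum_neg_distrib]
    congr 1
    · simp [Bc, fall, pp]
    · refine Finset.sum_congr rfl fun i hi' => ?_
      have h1 := (Finset.mem_Icc.mp hi').1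
      obtain ⟨j, rfl⟩ : ∃ j, i = j + 1 := ⟨i - 1, by omega⟩
      rw [Qi, Bc, Nat.add_sub_cancel, pow_succ]
      ring
  have T0 : ∀ m, Tp δ m n (lam δ 0) = 1 := by
    intro m; simp [Tp, lam_zero]
  have hA : variance (gd 0) P - Sbound P δ (pq δ β γ) 0 n gd =
      (∑ i ∈ Finset.range (n+1), (-1:ℝ)^i * Bc δ 0 n i * Q i)
        - ∑ k ∈ Finset.range (n+1), Tp δ 0 n (lam δ k) * c k := by
    rw [Bsum, split (fun k => Tp δ 0 n (lam δ k) * c k), T0,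
      Finset.sum_eq_zero (s := Finset.Icc 1 n) (f := fun k => Tp δ 0 n (lam δ k) * c k)
        (fun k hk => by
          have := Finset.mem_Icc.mp hk
          rw [Tp_eq_zero hδ (by omega) (by omega), zero_mul]), hvar, Sbound]
    simp only [Finset.Icc_eq_empty (show ¬ (1 ≤ 0) by omega), Finset.sum_empty]
    ring
  have hB : variance (gd 0) P - Sbound P δ (pq δ β γ) n n gd =
      (∑ i ∈ Finset.range (n+1), (-1:ℝ)^i * Bc δ n n i * Q i)
        - ∑ k ∈ Finset.range (n+1), Tp δ n n (lam δ k) * c k := by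
    rw [Bsum, split (fun k => Tp δ n n (lam δ k) * c k), T0, hvar, Sbound]
    have : ∑ i ∈ Finset.Icc 1 n, ((n.choose i : ℝ) * pp δ ((n : ℝ) + i) n /
          (fall ((n : ℝ) + n) i * (∫ x, pq δ β γ x ^ i ∂P) * pp δ ((i : ℝ) - 1) i *
            pp δ (n : ℝ) n)) *
        (∫ x, pq δ β γ x ^ i * gd i x ∂P) ^ 2 =
        ∑ k ∈ Finset.Icc 1 n, Tp δ n n (lam δ k) * c k := by
      refine Finset.sum_congr rfl fun i hi' => ?_
      obtain ⟨h1, h2⟩ := Finset.mem_Icc.mp hi'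
      obtain ⟨h3, h4⟩ := lin i h2
      have h1r : (1:ℝ) ≤ i := by exact_mod_cast h1
      have h2r : (i:ℝ) ≤ n := by exact_mod_cast h2
      have h5 := pp_pos hδ (show (0:ℝ) ≤ (i:ℝ) - 1 by linarith) i
      have h6 := pp_pos hδ (show (0:ℝ) ≤ (n:ℝ) by positivity) n
      have h7 := fall_pos (show (i:ℝ) ≤ (n:ℝ) + n by linarith)
      rw [Wi, Li, h4, piL_self, Tp_self hδ n i h2]
      field_simp
      rfl
    rw [this]
    ring
  have fin := final_arith hδ hn c (H.ck_nn (gd 0)) _ _ (tail 0) (tail n)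
  rw [← hA, ← hB] at fin
  refine ⟨fin.1, fin.2.trans ?_⟩
  have h0 := hsq 0 (by omega)
  exact H.poly_iff (gd 0) (hc 0 (by omega)) h0 n

end
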